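/- Let n ≥ 2 and α ∈ ℝ. Then the infimum of ∫_{ℝⁿ} |x|^α |Δu|² dx / ∫_{ℝⁿ} |x|^{α−4} |u|² dx over all nonzero u ∈ C²_c(ℝⁿ∖{0}) satisfying ∫_{∂B_r} u dσ = 0 for every r > 0 (zero mean over every sphere centered at the origin) equals min over integers k ≥ 1 of |γ_{n,α} + k(n−2+k)|². -/

import Mathlib

open MeasureTheory Metric Set Filter
open scoped RealInnerProductSpace

noncomputable section

/-- The Euclidean Laplacian of `u : ℝⁿ → ℝ` at a point. -/
def lap {n : ℕ} (u : EuclideanSpace ℝ (Fin n) → ℝ) (x : EuclideanSpace ℝ (Fin n)) : ℝ :=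
  ∑ i : Fin n, iteratedFDeriv ℝ 2 u x ![EuclideanSpace.single i 1, EuclideanSpace.single i 1]

/-- The Laplace–Beltrami operator on the unit sphere, computed via the
`0`-homogeneous extension: for a `0`-homogeneous function the Euclidean Laplacian
restricted to the unit sphere is exactly the Laplace–Beltrami operator. -/
def sphLap {n : ℕ} (φ : EuclideanSpace ℝ (Fin n) → ℝ) (σ : EuclideanSpace ℝ (Fin n)) : ℝ :=
  lap (fun x => φ (‖x‖⁻¹ • x)) σ

/-- Squared norm of the spherical gradient, via the `0`-homogeneous extension. -/
def sphGradNormSq {n : ℕ} (φ : EuclideanSpace ℝ (Fin n) → ℝ) (σ : EuclideanSpace ℝ (Fin n)) : ℝ :=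
  ‖fderiv ℝ (fun x => φ (‖x‖⁻¹ • x)) σ‖ ^ 2

/-- The open cone `C_Σ = {rσ : r > 0, σ ∈ Σ}` over a subset of the unit sphere. -/
def coneOf {n : ℕ} (S : Set (EuclideanSpace ℝ (Fin n))) : Set (EuclideanSpace ℝ (Fin n)) :=
  {x | x ≠ 0 ∧ ‖x‖⁻¹ • x ∈ S}

/-- The canonical surface measure `dσ` on the unit sphere of `ℝⁿ`, as a measure on `ℝⁿ`. -/
def sphMeasure (n : ℕ) : Measure (EuclideanSpace ℝ (Fin n)) :=
  Measure.map Subtype.val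
    ((volume : Measure (EuclideanSpace ℝ (Fin n))).toSphere)

/-- A (Dirichlet) eigenfunction of the Laplace–Beltrami operator on `S ⊆ 𝕊^{n-1}`
relative to the eigenvalue `lam`. -/
def IsEigenfun {n : ℕ} (S : Set (EuclideanSpace ℝ (Fin n))) (lam : ℝ)
    (φ : EuclideanSpace ℝ (Fin n) → ℝ) : Prop :=
  ContinuousOn (fun x => φ (‖x‖⁻¹ • x)) (coneOf (closure S)) ∧
  ContDiffOn ℝ 2 (fun x => φ (‖x‖⁻¹ • x)) (coneOf S) ∧
  (∀ σ ∈ closure S \ S, φ σ = 0) ∧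
  (∃ σ ∈ S, φ σ ≠ 0) ∧
  (∀ σ ∈ S, - sphLap φ σ = lam * φ σ)

/-- The Dirichlet spectrum `Λ(Σ)` of the Laplace–Beltrami operator on `S`. -/
def spec {n : ℕ} (S : Set (EuclideanSpace ℝ (Fin n))) : Set ℝ :=
  {lam | ∃ φ, IsEigenfun S lam φ}

/-- `S` is a domain in the unit sphere `𝕊^{n-1}`: a relatively open connected
nonempty subset. -/
def IsSphDomain {n : ℕ} (S : Set (EuclideanSpace ℝ (Fin n))) : Prop :=
  S ⊆ Metric.sphere (0 : EuclideanSpace ℝ (Fin n)) 1 ∧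
  IsOpen (Subtype.val ⁻¹' S : Set (Metric.sphere (0 : EuclideanSpace ℝ (Fin n)) 1)) ∧
  IsConnected S

/-- `S` is a domain of class `C²` in the unit sphere: a domain such that the cone
over it admits local `C²` defining functions away from the origin. -/
def IsC2SphDomain {n : ℕ} (S : Set (EuclideanSpace ℝ (Fin n))) : Prop :=
  IsSphDomain S ∧
  ∀ x ∈ frontier (coneOf S) \ {0}, ∃ (U : Set (EuclideanSpace ℝ (Fin n)))
    (f : EuclideanSpace ℝ (Fin n) → ℝ), IsOpen U ∧ x ∈ U ∧ ContDiff ℝ 2 f ∧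
    fderiv ℝ f x ≠ 0 ∧ coneOf S ∩ U = {y ∈ U | f y < 0}

/-- `γ_{n,α} = ((n-2)/2)² - ((α-2)/2)²`. -/
def gam (n : ℕ) (α : ℝ) : ℝ := (((n : ℝ) - 2) / 2) ^ 2 - ((α - 2) / 2) ^ 2

/-- `γ̄_{n,α} = ((n-2)/2)² + ((α-2)/2)²`. -/
def gbar (n : ℕ) (α : ℝ) : ℝ := (((n : ℝ) - 2) / 2) ^ 2 + ((α - 2) / 2) ^ 2

/-- The class `C²_c(Ω̄ ∖ {0})` of Navier test functions: `C²` up to the closure of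
`Ω`, vanishing on `∂Ω` and in a neighborhood of `0` and of `∞`. -/
def NavierAdm {n : ℕ} (Ω : Set (EuclideanSpace ℝ (Fin n)))
    (u : EuclideanSpace ℝ (Fin n) → ℝ) : Prop :=
  ContDiffOn ℝ 2 u (closure Ω) ∧
  (∀ x ∈ frontier Ω, u x = 0) ∧
  (∃ ε > 0, ∀ x : EuclideanSpace ℝ (Fin n), ‖x‖ < ε → u x = 0) ∧
  (∃ R : ℝ, ∀ x : EuclideanSpace ℝ (Fin n), R < ‖x‖ → u x = 0)

/-- The class `C²_c(Ω)` of Dirichlet test functions: globally `C²` with compact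
support contained in `Ω`. -/
def DirichletAdm {n : ℕ} (Ω : Set (EuclideanSpace ℝ (Fin n)))
    (u : EuclideanSpace ℝ (Fin n) → ℝ) : Prop :=
  ContDiff ℝ 2 u ∧ HasCompactSupport u ∧ tsupport u ⊆ Ω

/-- The best Rellich constant `μ_N(Ω;α)` under Navier boundary conditions. -/
def muN {n : ℕ} (Ω : Set (EuclideanSpace ℝ (Fin n))) (α : ℝ) : ℝ :=
  sInf {q : ℝ | ∃ u, NavierAdm Ω u ∧ (∃ x ∈ Ω, u x ≠ 0) ∧
    q = (∫ x in Ω, ‖x‖ ^ α * (lap u x) ^ 2) / (∫ x in Ω, ‖x‖ ^ (α - 4) * (u x) ^ 2)}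

/-- The best Rellich constant `μ_D(Ω;α)` under Dirichlet boundary conditions. -/
def muD {n : ℕ} (Ω : Set (EuclideanSpace ℝ (Fin n))) (α : ℝ) : ℝ :=
  sInf {q : ℝ | ∃ u, DirichletAdm Ω u ∧ (∃ x ∈ Ω, u x ≠ 0) ∧
    q = (∫ x in Ω, ‖x‖ ^ α * (lap u x) ^ 2) / (∫ x in Ω, ‖x‖ ^ (α - 4) * (u x) ^ 2)}

/-- The surrogate of `H² ∩ H¹₀(Σ)`: functions whose `0`-homogeneous extension is
`C²` up to the closure of the cone, vanishing on the relative boundary of `S`. -/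
def NavAdmS {n : ℕ} (S : Set (EuclideanSpace ℝ (Fin n)))
    (φ : EuclideanSpace ℝ (Fin n) → ℝ) : Prop :=
  ContDiffOn ℝ 2 (fun x => φ (‖x‖⁻¹ • x)) (coneOf (closure S)) ∧
  (∀ σ ∈ closure S \ S, φ σ = 0)

/-- The surrogate of `H²₀(Σ)`: as `NavAdmS`, with in addition vanishing gradient
on the relative boundary of `S`. -/
def DirAdmS {n : ℕ} (S : Set (EuclideanSpace ℝ (Fin n)))
    (φ : EuclideanSpace ℝ (Fin n) → ℝ) : Prop :=
  NavAdmS S φ ∧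
  ∀ σ ∈ closure S \ S,
    fderivWithin ℝ (fun x => φ (‖x‖⁻¹ • x)) (coneOf (closure S)) σ = 0

/-- The Rayleigh-type quotient `∫_Σ |Lφ|² dσ / ∫_Σ |φ|² dσ` with
`Lφ = -Δ_σ φ + γ φ`. -/
def sphQuot {n : ℕ} (S : Set (EuclideanSpace ℝ (Fin n))) (γ : ℝ)
    (φ : EuclideanSpace ℝ (Fin n) → ℝ) : ℝ :=
  (∫ σ in S, (- sphLap φ σ + γ * φ σ) ^ 2 ∂(sphMeasure n)) /
    (∫ σ in S, (φ σ) ^ 2 ∂(sphMeasure n))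

/-- Partial derivative `w_s` of a function on the cylinder `ℝ × 𝕊^{n-1}`. -/
def ws {n : ℕ} (w : ℝ × EuclideanSpace ℝ (Fin n) → ℝ)
    (p : ℝ × EuclideanSpace ℝ (Fin n)) : ℝ :=
  deriv (fun t => w (t, p.2)) p.1

/-- Second partial derivative `w_ss` of a function on the cylinder. -/
def wss {n : ℕ} (w : ℝ × EuclideanSpace ℝ (Fin n) → ℝ)
    (p : ℝ × EuclideanSpace ℝ (Fin n)) : ℝ :=
  deriv (fun t => ws w (t, p.2)) p.1

end

noncomputable section

abbrev EV (n : ℕ) := EuclideanSpace ℝ (Fin n)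

instance sphFinite (n : ℕ) : IsFiniteMeasure (sphMeasure n) := by
  unfold sphMeasure; infer_instance

lemma sph_integral {n : ℕ} (g : EV n → ℝ) :
    ∫ σ, g σ ∂(sphMeasure n) = ∫ σ : sphere (0 : EV n) 1, g σ ∂(volume : Measure (EV n)).toSphere := by
  unfold sphMeasure
  exact (MeasurableEmbedding.subtype_coe (isClosed_sphere.measurableSet)).integral_map g

lemma sph_ae (n : ℕ) : ∀ᵐ σ ∂(sphMeasure n), ‖σ‖ = 1 := by
  unfold sphMeasure
  rw [(MeasurableEmbedding.subtype_coe (isClosed_sphere.measurableSet)).ae_map_iff]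
  refine Eventually.of_forall fun σ => by simp

lemma sph_congr {n : ℕ} {f g : EV n → ℝ} (h : ∀ σ, ‖σ‖ = 1 → f σ = g σ) :
    ∫ σ, f σ ∂(sphMeasure n) = ∫ σ, g σ ∂(sphMeasure n) := by
  apply integral_congr_ae
  filter_upwards [sph_ae n] with σ hσ using h σ hσ

lemma sph_bdd {n : ℕ} {f : EV n → ℝ} (hf : Continuous f) :
    ∃ C, ∀ σ, ‖σ‖ = 1 → ‖f σ‖ ≤ C := by
  obtain ⟨C, hC⟩ := (isCompact_sphere (0 : EV n) 1).exists_bound_of_continuousOn hf.continuousOn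
  exact ⟨C, fun σ hσ => hC σ (by simpa using hσ)⟩

lemma sph_integrable {n : ℕ} {f : EV n → ℝ} (hf : Continuous f) :
    Integrable f (sphMeasure n) := by
  obtain ⟨C, hC⟩ := sph_bdd hf
  refine Integrable.of_bound hf.aestronglyMeasurable C ?_
  filter_upwards [sph_ae n] with σ hσ using hC σ hσ

lemma sph_zero {n : ℕ} {q : EV n → ℝ} (hq : Continuous q)
    (h : ∫ σ, (q σ) ^ 2 ∂(sphMeasure n) = 0) : ∀ σ, ‖σ‖ = 1 → q σ = 0 := by
  rw [sph_integral] at h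
  have hc : Continuous (fun σ : sphere (0 : EV n) 1 => (q σ) ^ 2) := by fun_prop
  have hi : Integrable (fun σ : sphere (0 : EV n) 1 => (q σ) ^ 2)
      (volume : Measure (EV n)).toSphere := by
    have := sph_integrable (n := n) (f := fun x => q x ^ 2) (by fun_prop)
    unfold sphMeasure at this
    rwa [(MeasurableEmbedding.subtype_coe (isClosed_sphere.measurableSet)).integrable_map_iff] at this
  rw [integral_eq_zero_iff_of_nonneg (fun σ => by positivity) hi] at h
  have := Continuous.ae_eq_iff_eq (volume : Measure (EV n)).toSphere hc
    (continuous_const (y := (0:ℝ))) |>.1 h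
  intro σ hσ
  have h2 := congrFun this ⟨σ, by simpa using hσ⟩
  simpa using h2

lemma sph_rot {n : ℕ} (R : EV n ≃ₗᵢ[ℝ] EV n) (h : EV n → ℝ) :
    ∫ σ, h (R σ) ∂(sphMeasure n) = ∫ σ, h σ ∂(sphMeasure n) := by
  have key : MeasurePreserving R (sphMeasure n) (sphMeasure n) := by
    refine ⟨R.continuous.measurable, ?_⟩
    ext s hs
    have hm := MeasurableEmbedding.subtype_coe (isClosed_sphere (x := (0 : EV n)) (ε := 1)).measurableSet
    rw [Measure.map_apply R.continuous.measurable hs]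
    unfold sphMeasure
    rw [Measure.map_apply hm.measurable hs,
      Measure.map_apply hm.measurable (R.continuous.measurable hs),
      Measure.toSphere_apply' _ (hm.measurable hs),
      Measure.toSphere_apply' _ (hm.measurable (R.continuous.measurable hs))]
    congr 1
    symm
    rw [← (R.measurePreserving).measure_preimage_equiv (f := R.toMeasurableEquiv)]
    congr 1
    ext x
    simp only [Set.mem_smul, Set.mem_preimage, Set.mem_image, Subtype.exists]
    constructor
    · rintro ⟨t, ht, _, ⟨y, hy, hy2, rfl⟩, he⟩
      refine ⟨t, ht, R.symm y, ⟨R.symm y, by simpa using hy, by simpa using hy2, rfl⟩, ?_⟩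
      apply R.injective
      simpa using he
    · rintro ⟨t, ht, _, ⟨y, hy, hy2, rfl⟩, rfl⟩
      refine ⟨t, ht, R y, ⟨R y, by simpa using hy, hy2, rfl⟩, by simp⟩
  exact key.integral_comp (R.toHomeomorph.measurableEmbedding) h

lemma sph_continuous {n : ℕ} {X : Type*} [TopologicalSpace X] [FirstCountableTopology X]
    [LocallyCompactSpace X] {G : X → EV n → ℝ}
    (hG : Continuous (Function.uncurry G)) :
    Continuous (fun s => ∫ σ, G s σ ∂(sphMeasure n)) := by
  rw [continuous_iff_continuousAt]
  intro s
  obtain ⟨K, hK, hKs⟩ := exists_compact_mem_nhds s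
  obtain ⟨C, hC⟩ := (hK.prod (isCompact_sphere (0 : EV n) 1)).exists_bound_of_continuousOn
    hG.continuousOn
  refine continuousAt_of_dominated (bound := fun _ => C) ?_ ?_ (integrable_const _) ?_
  · exact Eventually.of_forall fun x => (show Continuous (G x) from by fun_prop).aestronglyMeasurable
  · filter_upwards [hKs] with x hx
    filter_upwards [sph_ae n] with σ hσ using hC (x, σ) ⟨hx, by simpa using hσ⟩
  · exact Eventually.of_forall fun σ => (show Continuous (fun x => G x σ) from by fun_prop).continuousAt

lemma sph_deriv {n : ℕ} {G G' : ℝ → EV n → ℝ}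
    (hG : Continuous (Function.uncurry G)) (hG' : Continuous (Function.uncurry G'))
    (hd : ∀ s σ, ‖σ‖ = 1 → HasDerivAt (fun t => G t σ) (G' s σ) s) (s : ℝ) :
    HasDerivAt (fun s => ∫ σ, G s σ ∂(sphMeasure n)) (∫ σ, G' s σ ∂(sphMeasure n)) s := by
  obtain ⟨C, hC⟩ := ((isCompact_closedBall s 1).prod
    (isCompact_sphere (0 : EV n) 1)).exists_bound_of_continuousOn hG'.continuousOn
  have c1 : ∀ x, Continuous (G x) := fun x => by fun_prop
  have c2 : ∀ x, Continuous (G' x) := fun x => by fun_prop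
  refine (hasDerivAt_integral_of_dominated_loc_of_deriv_le (bound := fun _ => C)
    (closedBall_mem_nhds s one_pos) ?_ (sph_integrable (c1 s)) (c2 s).aestronglyMeasurable ?_
    (integrable_const _) ?_).2
  · exact Eventually.of_forall fun x => (c1 x).aestronglyMeasurable
  · filter_upwards [sph_ae n] with σ hσ x hx using hC (x, σ) ⟨hx, by simpa using hσ⟩
  · filter_upwards [sph_ae n] with σ hσ x hx using hd x σ hσ

lemma polar_log {n : ℕ} (hn : 2 ≤ n) {g : EV n → ℝ} (hg : Integrable g) :
    ∫ x, g x = ∫ s : ℝ, Real.exp (n * s) * ∫ σ, g (Real.exp s • σ) ∂(sphMeasure n) := by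
  have : Nonempty (Fin n) := ⟨⟨0, by omega⟩⟩
  have : Nontrivial (EV n) := inferInstance
  have hfr : Module.finrank ℝ (EV n) = n := by simp
  have mp := (volume : Measure (EV n)).measurePreserving_homeomorphUnitSphereProd
  have hemb := (homeomorphUnitSphereProd (EV n)).measurableEmbedding
  rw [hfr] at mp
  set G : sphere (0 : EV n) 1 × Ioi (0:ℝ) → ℝ := fun p => g (p.2.1 • p.1.1) with hGdef
  have hGc : ∀ x : ({(0 : EV n)}ᶜ : Set (EV n)), G (homeomorphUnitSphereProd (EV n) x) = g x := by
    intro x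
    have : (x : EV n) ≠ 0 := x.2
    simp [hGdef, smul_smul, this]
  have hGi : Integrable G ((volume : Measure (EV n)).toSphere.prod (Measure.volumeIoiPow (n - 1))) := by
    rw [← mp.integrable_comp_emb hemb]
    have : G ∘ (homeomorphUnitSphereProd (EV n)) = g ∘ Subtype.val := by
      ext x; exact hGc x
    rw [this, ← integrableOn_iff_comap_subtypeVal (by measurability)]
    exact hg.integrableOn
  calc ∫ x, g x = ∫ x : ({(0)}ᶜ : Set (EV n)), g x.1 ∂((volume : Measure (EV n)).comap (↑)) := by
        rw [integral_subtype_comap (measurableSet_singleton _).compl g,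
          restrict_compl_singleton]
    _ = ∫ p, G p ∂((volume : Measure (EV n)).toSphere.prod (Measure.volumeIoiPow (n - 1))) := by
        rw [← mp.integral_comp hemb]
        exact integral_congr_ae (Eventually.of_forall fun x => (hGc x).symm)
    _ = ∫ r, (∫ σ, g (r.1 • σ) ∂(sphMeasure n)) ∂(Measure.volumeIoiPow (n - 1)) := by
        rw [integral_prod_symm _ hGi]
        refine integral_congr_ae (Eventually.of_forall fun r => ?_)
        simp only [hGdef]
        rw [sph_integral (fun σ => g (r.1 • σ))]
    _ = ∫ r in Ioi (0:ℝ), r ^ (n - 1) * (∫ σ, g (r • σ) ∂(sphMeasure n)) := by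
        simp only [Measure.volumeIoiPow, ENNReal.ofReal]
        rw [integral_withDensity_eq_integral_smul,
          integral_subtype_comap measurableSet_Ioi
            fun a ↦ Real.toNNReal (a ^ (n - 1)) • ∫ σ, g (a • σ) ∂(sphMeasure n),
          setIntegral_congr_fun measurableSet_Ioi fun x hx ↦ ?_]
        · rw [NNReal.smul_def, Real.coe_toNNReal _ (pow_nonneg hx.out.le _), smul_eq_mul]
        · exact (measurable_subtype_coe.pow_const _).real_toNNReal
    _ = _ := by
        have h := integral_image_eq_integral_abs_deriv_smul (s := univ) (f := Real.exp)
          (f' := Real.exp) MeasurableSet.univ (fun x _ => (Real.hasDerivAt_exp x).hasDerivWithinAt)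
          Real.exp_injective.injOn (fun r => r ^ (n - 1) * (∫ σ, g (r • σ) ∂(sphMeasure n)))
        rw [image_univ, Real.range_exp] at h
        rw [h, Measure.restrict_univ]
        refine integral_congr_ae (Eventually.of_forall fun s => ?_)
        simp only [smul_eq_mul, abs_of_pos (Real.exp_pos s)]
        rw [← mul_assoc, ← Real.exp_nat_mul, ← Real.exp_add]
        congr 2
        rw [Nat.cast_sub (by omega)]; push_cast; ring

def eb {n : ℕ} (i : Fin n) : EV n := EuclideanSpace.single i 1

def Jm {n : ℕ} (i j : Fin n) : EV n →L[ℝ] EV n :=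
  (EuclideanSpace.proj i).smulRight (eb j) - (EuclideanSpace.proj j).smulRight (eb i)

lemma Jm_apply {n : ℕ} (i j : Fin n) (x : EV n) : Jm i j x = x i • eb j - x j • eb i := by
  simp [Jm]

lemma eb_apply {n : ℕ} (i j : Fin n) : (eb i : EV n) j = if j = i then 1 else 0 := by
  simp [eb, Pi.single_apply]

lemma Jm_skew {n : ℕ} (i j : Fin n) (x y : EV n) : ⟪Jm i j x, y⟫ = - ⟪x, Jm i j y⟫ := by
  simp only [Jm_apply, inner_sub_left, inner_sub_right, inner_smul_left, inner_smul_right, eb,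
    EuclideanSpace.inner_single_left, EuclideanSpace.inner_single_right]
  simp
  ring

lemma Jm_cube {n : ℕ} (i j : Fin n) (x : EV n) : Jm i j (Jm i j (Jm i j x)) = - Jm i j x := by
  ext k
  simp only [Jm_apply, PiLp.sub_apply, PiLp.smul_apply, PiLp.neg_apply, eb_apply, smul_eq_mul]
  by_cases h : i = j
  · subst h; simp
  · have h' : ¬ j = i := fun e => h e.symm
    simp only [h, h', if_true, if_false]
    ring

def rotL {n : ℕ} (i j : Fin n) (t : ℝ) : EV n →ₗᵢ[ℝ] EV n where
  toLinearMap := (ContinuousLinearMap.id ℝ (EV n) + (1 - Real.cos t) • ((Jm i j).comp (Jm i j))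
    + Real.sin t • Jm i j).toLinearMap
  norm_map' := by
    intro x
    simp only [ContinuousLinearMap.coe_coe, _root_.add_apply,
      _root_.smul_apply, ContinuousLinearMap.comp_apply, ContinuousLinearMap.id_apply]
    rw [← sq_eq_sq₀ (norm_nonneg _) (norm_nonneg _)]
    rw [← real_inner_self_eq_norm_sq, ← real_inner_self_eq_norm_sq]
    set J := Jm i j
    have sk : ∀ x y, ⟪J x, y⟫ = - ⟪x, J y⟫ := Jm_skew i j
    have cu : J (J (J x)) = - J x := Jm_cube i j x
    have h1 : ⟪x, J x⟫ = 0 := by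
      have := sk x x
      rw [real_inner_comm] at this
      linarith
    simp only [inner_add_left, inner_add_right, inner_smul_left, inner_smul_right, sk, cu, map_neg,
      inner_neg_right, neg_neg, h1]
    simp
    have := Real.sin_sq_add_cos_sq t
    linear_combination (- ⟪x, J (J x)⟫) * this

lemma rotL_apply {n : ℕ} (i j : Fin n) (t : ℝ) (x : EV n) :
    rotL i j t x = x + (1 - Real.cos t) • Jm i j (Jm i j x) + Real.sin t • Jm i j x := rfl

def Lop {n : ℕ} (J : EV n →L[ℝ] EV n) (v : EV n → ℝ) (x : EV n) : ℝ := fderiv ℝ v x (J x)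

lemma Lop_contDiff {n : ℕ} (J : EV n →L[ℝ] EV n) {v : EV n → ℝ} (hv : ContDiff ℝ 2 v) :
    ContDiff ℝ 1 (Lop J v) := by
  unfold Lop
  exact (hv.fderiv_right (m := 1) (by norm_num)).clm_apply J.contDiff

lemma sph_Lop_zero {n : ℕ} (i j : Fin n) {h : EV n → ℝ} (hh : ContDiff ℝ 1 h) :
    ∫ σ, Lop (Jm i j) h σ ∂(sphMeasure n) = 0 := by
  have hc : Continuous (fun p : ℝ × EV n => rotL i j p.1 p.2) := by
    simp only [rotL_apply]; fun_prop
  have hL : Continuous (Lop (Jm i j) h) := by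
    unfold Lop
    exact (hh.continuous_fderiv (by norm_num)).clm_apply (Jm i j).continuous
  have hd := sph_deriv (n := n) (G := fun t σ => h (rotL i j t σ))
    (G' := fun t σ => Lop (Jm i j) h (rotL i j t σ))
    (hh.continuous.comp hc) (hL.comp hc) (by
      intro t σ _
      have h1 : HasDerivAt (fun t => rotL i j t σ) (Jm i j (rotL i j t σ)) t := by
        simp only [rotL_apply, map_add, map_smul, Jm_cube]
        have a := (Real.hasDerivAt_cos t).const_sub 1 |>.smul_const (Jm i j (Jm i j σ))
        have b := (Real.hasDerivAt_sin t).smul_const (Jm i j σ)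
        refine HasDerivAt.congr_deriv ((a.const_add σ).add b) ?_
        module
      exact ((hh.differentiable (by norm_num)) (rotL i j t σ)).hasFDerivAt.comp_hasDerivAt t h1) 0
  have hconst : (fun s => ∫ σ, h (rotL i j s σ) ∂(sphMeasure n)) =
      fun _ => ∫ σ, h σ ∂(sphMeasure n) := by
    funext s
    exact sph_rot ((rotL i j s).toLinearIsometryEquiv rfl) h
  rw [hconst] at hd
  have := hd.unique (hasDerivAt_const (0:ℝ) _)
  simpa [rotL_apply] using this

lemma Lop_Lop {n : ℕ} (J : EV n →L[ℝ] EV n) {v : EV n → ℝ} (hv : ContDiff ℝ 2 v) (x : EV n) :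
    Lop J (Lop J v) x = fderiv ℝ (fderiv ℝ v) x (J x) (J x) + fderiv ℝ v x (J (J x)) := by
  have h1 : HasFDerivAt (fderiv ℝ v) (fderiv ℝ (fderiv ℝ v) x) x :=
    ((hv.fderiv_right (m := 1) (by norm_num)).differentiable (by norm_num) x).hasFDerivAt
  have h2 := h1.clm_apply J.hasFDerivAt
  change fderiv ℝ (fun y => fderiv ℝ v y (J y)) x (J x) = _
  rw [h2.fderiv]
  simp [add_comm]

def Aop {n : ℕ} (v : EV n → ℝ) (x : EV n) : ℝ :=
  ‖x‖ ^ 2 * lap v x - fderiv ℝ (fderiv ℝ v) x x x - ((n : ℝ) - 1) * fderiv ℝ v x x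

lemma lap_eq {n : ℕ} (v : EV n → ℝ) (x : EV n) :
    lap v x = ∑ i, fderiv ℝ (fderiv ℝ v) x (eb i) (eb i) := by
  unfold lap
  simp [iteratedFDeriv_two_apply, eb]

lemma ev_expand {n : ℕ} (x : EV n) : x = ∑ i, x i • eb i := by
  ext k
  simp [eb_apply, WithLp.ofLp_sum]

lemma Aop_eq {n : ℕ} {v : EV n → ℝ} (hv : ContDiff ℝ 2 v) (x : EV n) :
    Aop v x = (1 / 2) * ∑ i, ∑ j, Lop (Jm i j) (Lop (Jm i j) v) x := by
  simp only [Lop_Lop _ hv, Aop, lap_eq]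
  set B := fderiv ℝ (fderiv ℝ v) x
  set l := fderiv ℝ v x
  have hl : l x = ∑ i, x i * l (eb i) := by
    conv_lhs => rw [ev_expand x]
    simp
  have hB : B x x = ∑ i, ∑ j, x i * x j * B (eb i) (eb j) := by
    conv_lhs => rw [ev_expand x]
    simp only [map_sum, map_smul, _root_.sum_apply, _root_.smul_apply,
      smul_eq_mul, Finset.mul_sum]
    rw [Finset.sum_comm]
    refine Finset.sum_congr rfl fun i _ => Finset.sum_congr rfl fun j _ => by ring
  have hB' : B x x = ∑ i, ∑ j, x i * x j * B (eb j) (eb i) := by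
    rw [hB, Finset.sum_comm]
    refine Finset.sum_congr rfl fun i _ => Finset.sum_congr rfl fun j _ => by ring
  have hN : ‖x‖ ^ 2 = ∑ i, x i ^ 2 := by
    rw [EuclideanSpace.norm_sq_eq]; simp
  have e1 : ∀ i j, B (Jm i j x) (Jm i j x) = x i ^ 2 * B (eb j) (eb j) + x j ^ 2 * B (eb i) (eb i)
      - x i * x j * B (eb i) (eb j) - x i * x j * B (eb j) (eb i) := by
    intro i j
    simp only [Jm_apply, map_sub, map_smul, _root_.sub_apply,
      _root_.smul_apply, smul_eq_mul]
    ring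
  have e2 : ∀ i j, l (Jm i j (Jm i j x)) = (if i = j then x i * l (eb i) + x i * l (eb i) else 0)
      - x j * l (eb j) - x i * l (eb i) := by
    intro i j
    simp only [Jm_apply, map_sub, map_smul, smul_eq_mul, PiLp.sub_apply, PiLp.smul_apply, eb_apply]
    by_cases h : i = j
    · subst h; simp
    · have h' : ¬ j = i := fun e => h e.symm
      simp [h, h']
      ring
  have hn' : ∑ i, (n : ℝ) * (x i * l (eb i)) = n * l x := by rw [hl, Finset.mul_sum]
  have hn'' : ∑ i, (n : ℝ) * x i * l (eb i) = n * l x := by rw [← hn']; simp only [mul_assoc]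
  simp only [e1, e2, Finset.sum_add_distrib, Finset.sum_sub_distrib, Finset.sum_ite_eq,
    Finset.mem_univ, if_true, ← hB, ← hB', ← Finset.mul_sum, ← Finset.sum_mul, ← hN, ← hl,
    Finset.sum_const, Finset.card_univ, Fintype.card_fin, nsmul_eq_mul]
  ring_nf
  rw [hn'']
  ring

lemma Lop_mul {n : ℕ} (J : EV n →L[ℝ] EV n) {f g : EV n → ℝ} (hf : ContDiff ℝ 1 f)
    (hg : ContDiff ℝ 1 g) (x : EV n) :
    Lop J (fun y => f y * g y) x = f x * Lop J g x + g x * Lop J f x := by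
  have a := (hf.differentiable (by norm_num) x).hasFDerivAt
  have b := (hg.differentiable (by norm_num) x).hasFDerivAt
  unfold Lop
  have hm := (a.mul b).fderiv
  change fderiv ℝ (f * g) x (J x) = _
  rw [hm]
  simp

lemma Lop_sub {n : ℕ} (J : EV n →L[ℝ] EV n) {f g : EV n → ℝ} (hf : ContDiff ℝ 1 f)
    (hg : ContDiff ℝ 1 g) (x : EV n) :
    Lop J (fun y => f y - g y) x = Lop J f x - Lop J g x := by
  have a := (hf.differentiable (by norm_num) x).hasFDerivAt
  have b := (hg.differentiable (by norm_num) x).hasFDerivAt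
  unfold Lop
  have hm := (a.sub b).fderiv
  change fderiv ℝ (f - g) x (J x) = _
  rw [hm]
  simp

lemma LL_continuous {n : ℕ} (J : EV n →L[ℝ] EV n) {v : EV n → ℝ} (hv : ContDiff ℝ 2 v) :
    Continuous (Lop J (Lop J v)) := by
  have := (Lop_contDiff J hv).continuous_fderiv (by norm_num)
  unfold Lop
  exact this.clm_apply J.continuous

lemma LL_selfadj {n : ℕ} (i j : Fin n) {v w : EV n → ℝ} (hv : ContDiff ℝ 2 v)
    (hw : ContDiff ℝ 2 w) :
    ∫ σ, Lop (Jm i j) (Lop (Jm i j) v) σ * w σ ∂(sphMeasure n)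
      = ∫ σ, v σ * Lop (Jm i j) (Lop (Jm i j) w) σ ∂(sphMeasure n) := by
  set J := Jm i j
  have hv1 : ContDiff ℝ 1 v := hv.of_le (by norm_num)
  have hw1 : ContDiff ℝ 1 w := hw.of_le (by norm_num)
  have hLv := Lop_contDiff J hv
  have hLw := Lop_contDiff J hw
  have h0 := sph_Lop_zero i j ((hv1.mul hLw).sub (hw1.mul hLv))
  have he : ∀ σ, Lop J (fun y => v y * Lop J w y - w y * Lop J v y) σ
      = v σ * Lop J (Lop J w) σ - Lop J (Lop J v) σ * w σ := by
    intro σ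
    rw [Lop_sub J (hv1.mul hLw) (hw1.mul hLv), Lop_mul J hv1 hLw, Lop_mul J hw1 hLv]
    ring
  change ∫ σ, Lop J (fun y => v y * Lop J w y - w y * Lop J v y) σ ∂(sphMeasure n) = 0 at h0
  simp only [he] at h0
  have c1 := LL_continuous J hv
  have c2 := LL_continuous J hw
  have c3 := hv.continuous
  have c4 := hw.continuous
  rw [integral_sub (sph_integrable (by fun_prop)) (sph_integrable (by fun_prop))] at h0
  linarith

lemma Aop_continuous {n : ℕ} {v : EV n → ℝ} (hv : ContDiff ℝ 2 v) : Continuous (Aop v) := by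
  have : Aop v = fun x => (1 / 2) * ∑ i, ∑ j, Lop (Jm i j) (Lop (Jm i j) v) x :=
    funext (Aop_eq hv)
  rw [this]
  have := fun i j : Fin n => LL_continuous (Jm i j) hv
  fun_prop

lemma Aop_selfadj {n : ℕ} {v w : EV n → ℝ} (hv : ContDiff ℝ 2 v) (hw : ContDiff ℝ 2 w) :
    ∫ σ, Aop v σ * w σ ∂(sphMeasure n) = ∫ σ, v σ * Aop w σ ∂(sphMeasure n) := by
  have c1 := fun i j : Fin n => LL_continuous (Jm i j) hv
  have c2 := fun i j : Fin n => LL_continuous (Jm i j) hw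
  have c3 := hv.continuous
  have c4 := hw.continuous
  simp only [Aop_eq hv, Aop_eq hw, mul_assoc, Finset.sum_mul, mul_left_comm (v _), Finset.mul_sum]
  rw [integral_finsetSum _ fun i _ => sph_integrable (by fun_prop),
    integral_finsetSum _ fun i _ => sph_integrable (by fun_prop)]
  refine Finset.sum_congr rfl fun i _ => ?_
  rw [integral_finsetSum _ fun i _ => sph_integrable (by fun_prop),
    integral_finsetSum _ fun i _ => sph_integrable (by fun_prop)]
  refine Finset.sum_congr rfl fun j _ => ?_
  rw [integral_const_mul, integral_const_mul, LL_selfadj i j hv hw]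

/-- derivative along rays -/
lemma ray1 {n : ℕ} {v : EV n → ℝ} (hv : ContDiff ℝ 2 v) (x : EV n) (s : ℝ) :
    HasDerivAt (fun t => v (Real.exp t • x)) (fderiv ℝ v (Real.exp s • x) (Real.exp s • x)) s := by
  have h1 := (Real.hasDerivAt_exp s).smul_const x
  exact ((hv.differentiable (by norm_num)) (Real.exp s • x)).hasFDerivAt.comp_hasDerivAt s h1

lemma ray2 {n : ℕ} {v : EV n → ℝ} (hv : ContDiff ℝ 2 v) (x : EV n) (s : ℝ) :
    HasDerivAt (fun t => fderiv ℝ v (Real.exp t • x) (Real.exp t • x))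
      (fderiv ℝ (fderiv ℝ v) (Real.exp s • x) (Real.exp s • x) (Real.exp s • x)
        + fderiv ℝ v (Real.exp s • x) (Real.exp s • x)) s := by
  have h1 := (Real.hasDerivAt_exp s).smul_const x
  have h2 := (((hv.fderiv_right (m := 1) (by norm_num)).differentiable (by norm_num))
    (Real.exp s • x)).hasFDerivAt.comp_hasDerivAt s h1
  exact h2.clm_apply h1

lemma homog_Aop {n : ℕ} {v : EV n → ℝ} (hv : ContDiff ℝ 2 v) (N : ℝ)
    (hh : ∀ s x, v (Real.exp s • x) = Real.exp (N * s) * v x) (x : EV n) :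
    Aop v x = ‖x‖ ^ 2 * lap v x - N * ((n : ℝ) - 2 + N) * v x := by
  have hd : ∀ s, HasDerivAt (fun s => Real.exp (N * s) * v x) (N * (Real.exp (N * s) * v x)) s := by
    intro s
    have := (((hasDerivAt_id s).const_mul N).exp).mul_const (v x)
    refine this.congr_deriv ?_
    simp only [id, mul_one]; ring
  have h1 : ∀ s, fderiv ℝ v (Real.exp s • x) (Real.exp s • x) = N * (Real.exp (N * s) * v x) := by
    intro s
    have := ray1 hv x s
    simp only [hh] at this
    exact this.unique (hd s)
  have h2 := ray2 hv x 0
  simp only [h1] at h2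
  have h3 := h2.unique ((hd 0).const_mul N)
  have h4 := h1 0
  simp at h3 h4
  unfold Aop
  rw [h4]
  linear_combination -h3

lemma Lop_add {n : ℕ} (J : EV n →L[ℝ] EV n) {f g : EV n → ℝ} (hf : ContDiff ℝ 1 f)
    (hg : ContDiff ℝ 1 g) (x : EV n) :
    Lop J (fun y => f y + g y) x = Lop J f x + Lop J g x := by
  have a := (hf.differentiable (by norm_num) x).hasFDerivAt
  have b := (hg.differentiable (by norm_num) x).hasFDerivAt
  unfold Lop
  have hm := (a.add b).fderiv
  change fderiv ℝ (f + g) x (J x) = _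
  rw [hm]
  simp

lemma Lop_cmul {n : ℕ} (J : EV n →L[ℝ] EV n) (c : ℝ) {f : EV n → ℝ} (hf : ContDiff ℝ 1 f)
    (x : EV n) : Lop J (fun y => c * f y) x = c * Lop J f x := by
  have a := ((hf.differentiable (by norm_num) x).hasFDerivAt.const_mul c).fderiv
  unfold Lop
  rw [a]
  simp

lemma Aop_add {n : ℕ} {f g : EV n → ℝ} (hf : ContDiff ℝ 2 f) (hg : ContDiff ℝ 2 g) (x : EV n) :
    Aop (fun y => f y + g y) x = Aop f x + Aop g x := by
  have hf1 : ContDiff ℝ 1 f := hf.of_le (by norm_num)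
  have hg1 : ContDiff ℝ 1 g := hg.of_le (by norm_num)
  have h : ∀ J : EV n →L[ℝ] EV n, Lop J (Lop J (fun y => f y + g y)) x
      = Lop J (Lop J f) x + Lop J (Lop J g) x := by
    intro J
    rw [show Lop J (fun y => f y + g y) = fun y => Lop J f y + Lop J g y from
      funext (Lop_add J hf1 hg1), Lop_add J (Lop_contDiff J hf) (Lop_contDiff J hg)]
  rw [Aop_eq (hf.add hg), Aop_eq hf, Aop_eq hg, ← mul_add]
  simp only [h, Finset.sum_add_distrib]

lemma Aop_cmul {n : ℕ} (c : ℝ) {f : EV n → ℝ} (hf : ContDiff ℝ 2 f) (x : EV n) :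
    Aop (fun y => c * f y) x = c * Aop f x := by
  have hf1 : ContDiff ℝ 1 f := hf.of_le (by norm_num)
  have h : ∀ J : EV n →L[ℝ] EV n, Lop J (Lop J (fun y => c * f y)) x = c * Lop J (Lop J f) x := by
    intro J
    rw [show Lop J (fun y => c * f y) = fun y => c * Lop J f y from
      funext (Lop_cmul J c hf1), Lop_cmul J c (Lop_contDiff J hf)]
  rw [Aop_eq (contDiff_const.mul hf), Aop_eq hf]
  simp only [h, ← Finset.mul_sum]
  ring

lemma Aop_sum {n m : ℕ} (s : Finset (Fin m)) (c : Fin m → ℝ) {Y : Fin m → EV n → ℝ}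
    (hY : ∀ i, ContDiff ℝ 2 (Y i)) (x : EV n) :
    Aop (fun y => ∑ i ∈ s, c i * Y i y) x = ∑ i ∈ s, c i * Aop (Y i) x := by
  induction s using Finset.induction_on with
  | empty =>
    simp only [Finset.sum_empty]
    have := Aop_cmul (n := n) 0 (f := fun _ => 0) contDiff_const x
    simpa using this
  | insert a s ha ih =>
    simp only [Finset.sum_insert ha]
    rw [Aop_add (contDiff_const.mul (hY a))
      (ContDiff.sum fun i _ => contDiff_const.mul (hY i)), ih, Aop_cmul _ (hY a)]

/-! polynomials -/

def mono {n : ℕ} (l : List (Fin n)) : EV n → ℝ := fun x => (l.map (fun i => x i)).prod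

def Pol (n N : ℕ) : Submodule ℝ (EV n → ℝ) := Submodule.span ℝ (mono '' {l | l.length ≤ N})

lemma mono_nil {n : ℕ} : mono ([] : List (Fin n)) = fun _ => 1 := by ext; simp [mono]

lemma mono_cons {n : ℕ} (i : Fin n) (l : List (Fin n)) :
    mono (i :: l) = fun x => x i * mono l x := by ext; simp [mono]

lemma mono_mem {n N : ℕ} {l : List (Fin n)} (h : l.length ≤ N) : mono l ∈ Pol n N :=
  Submodule.subset_span ⟨l, h, rfl⟩

lemma Pol_mono {n N M : ℕ} (h : N ≤ M) : Pol n N ≤ Pol n M :=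
  Submodule.span_mono (image_mono fun _ hl => le_trans hl h)

lemma mono_contDiff {n : ℕ} (l : List (Fin n)) : ContDiff ℝ ⊤ (mono l) := by
  induction l with
  | nil => rw [mono_nil]; exact contDiff_const
  | cons i l ih =>
    rw [mono_cons]
    exact (EuclideanSpace.proj i : EV n →L[ℝ] ℝ).contDiff.mul ih

lemma Pol_contDiff {n N : ℕ} {p : EV n → ℝ} (hp : p ∈ Pol n N) : ContDiff ℝ ⊤ p := by
  induction hp using Submodule.span_induction with
  | mem x h => obtain ⟨l, _, rfl⟩ := h; exact mono_contDiff l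
  | zero => exact contDiff_const
  | add x y _ _ h1 h2 => exact h1.add h2
  | smul a x _ h => exact contDiff_const.smul h

lemma Pol_coord {n N : ℕ} (i : Fin n) {p : EV n → ℝ} (hp : p ∈ Pol n N) :
    (fun x => x i * p x) ∈ Pol n (N + 1) := by
  induction hp using Submodule.span_induction with
  | mem x h =>
    obtain ⟨l, hl, rfl⟩ := h
    rw [← mono_cons]
    exact mono_mem (by simpa using hl)
  | zero =>
    convert (Pol n (N+1)).zero_mem using 1
    ext; simp
  | add x y _ _ h1 h2 =>
    convert (Pol n (N+1)).add_mem h1 h2 using 1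
    ext; simp [mul_add]
  | smul a x _ h =>
    convert (Pol n (N+1)).smul_mem a h using 1
    ext; simp; ring

lemma mono_deriv {n : ℕ} (i : Fin n) (l : List (Fin n)) :
    (fun x => fderiv ℝ (mono l) x (eb i)) ∈ Pol n (l.length - 1) := by
  induction l with
  | nil =>
    rw [mono_nil]
    convert (Pol n _).zero_mem using 1
    ext; simp
  | cons j l ih =>
    have he : (fun x => fderiv ℝ (mono (j :: l)) x (eb i))
        = (eb i : EV n) j • mono l + (fun x => x j * fderiv ℝ (mono l) x (eb i)) := by
      ext x
      have a : HasFDerivAt (fun x : EV n => x j) (EuclideanSpace.proj j : EV n →L[ℝ] ℝ) x :=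
        (EuclideanSpace.proj j : EV n →L[ℝ] ℝ).hasFDerivAt
      have b := ((mono_contDiff l).differentiable (by simp) x).hasFDerivAt
      have hm := (a.mul b).fderiv
      rw [mono_cons]
      change fderiv ℝ ((fun x : EV n => x j) * mono l) x (eb i) = _
      rw [hm]
      simp
      ring
    rw [he]
    simp only [List.length_cons, Nat.add_sub_cancel]
    refine (Pol n _).add_mem ((Pol n _).smul_mem _ (mono_mem le_rfl)) ?_
    cases l with
    | nil =>
      rw [mono_nil]
      convert (Pol n _).zero_mem using 1
      ext; simp
    | cons k l' =>
      have := Pol_coord j ih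
      simpa using this

lemma Pol_deriv {n N : ℕ} (i : Fin n) {p : EV n → ℝ} (hp : p ∈ Pol n N) :
    (fun x => fderiv ℝ p x (eb i)) ∈ Pol n (N - 1) := by
  induction hp using Submodule.span_induction with
  | mem x h =>
    obtain ⟨l, hl, rfl⟩ := h
    exact Pol_mono (Nat.sub_le_sub_right hl 1) (mono_deriv i l)
  | zero =>
    convert (Pol n _).zero_mem using 1
    ext; simp
  | add p q hp hq h1 h2 =>
    convert (Pol n _).add_mem h1 h2 using 1
    ext x
    have := ((Pol_contDiff hp).differentiable (by simp) x).hasFDerivAt.add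
      ((Pol_contDiff hq).differentiable (by simp) x).hasFDerivAt
    rw [this.fderiv]; simp
  | smul a p hp h =>
    convert (Pol n _).smul_mem a h using 1
    ext x
    have := ((Pol_contDiff hp).differentiable (by simp) x).hasFDerivAt.const_smul a
    rw [this.fderiv]; simp

lemma lap_eq' {n : ℕ} {v : EV n → ℝ} (hv : ContDiff ℝ 2 v) (x : EV n) :
    lap v x = ∑ i, fderiv ℝ (fun y => fderiv ℝ v y (eb i)) x (eb i) := by
  rw [lap_eq]
  refine Finset.sum_congr rfl fun i _ => ?_
  have h1 : HasFDerivAt (fderiv ℝ v) (fderiv ℝ (fderiv ℝ v) x) x :=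
    ((hv.fderiv_right (m := 1) (by norm_num)).differentiable (by norm_num) x).hasFDerivAt
  have h2 := h1.clm_apply (hasFDerivAt_const (eb i : EV n) x)
  rw [h2.fderiv]; simp

lemma Pol_lap {n N : ℕ} {p : EV n → ℝ} (hp : p ∈ Pol n N) : lap p ∈ Pol n (N - 1) := by
  have : lap p = ∑ i, fun x => fderiv ℝ (fun y => fderiv ℝ p y (eb i)) x (eb i) := by
    ext x
    rw [lap_eq' ((Pol_contDiff hp).of_le (by simp))]
    simp
  rw [this]
  refine Submodule.sum_mem _ fun i _ => ?_
  exact Pol_mono (by omega) (Pol_deriv i (Pol_deriv i hp))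

lemma Pol_mul {n N M : ℕ} {p q : EV n → ℝ} (hp : p ∈ Pol n N) (hq : q ∈ Pol n M) :
    (fun x => p x * q x) ∈ Pol n (N + M) := by
  induction hp using Submodule.span_induction with
  | mem x h =>
    obtain ⟨l, hl, rfl⟩ := h
    have : ∀ l : List (Fin n), (fun x => mono l x * q x) ∈ Pol n (l.length + M) := by
      intro l
      induction l with
      | nil => simpa [mono_nil] using hq
      | cons i l ih =>
        have := Pol_coord i ih
        rw [mono_cons]
        simp only [List.length_cons]
        rw [show l.length + 1 + M = l.length + M + 1 by omega]
        simpa only [mul_assoc] using this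
    exact Pol_mono (Nat.add_le_add_right hl M) (this l)
  | zero =>
    convert (Pol n _).zero_mem using 1
    ext; simp
  | add p q _ _ h1 h2 =>
    convert (Pol n _).add_mem h1 h2 using 1
    ext; simp [add_mul]
  | smul a p _ h =>
    convert (Pol n _).smul_mem a h using 1
    ext; simp; ring

lemma mono_homog {n : ℕ} (l : List (Fin n)) (r : ℝ) (x : EV n) :
    mono l (r • x) = r ^ l.length * mono l x := by
  induction l with
  | nil => simp [mono_nil]
  | cons i l ih => simp [mono_cons, ih, pow_succ]; ring

lemma Pol_scale {n N : ℕ} (r : ℝ) {p : EV n → ℝ} (hp : p ∈ Pol n N) :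
    (fun x => p (r • x)) ∈ Pol n N := by
  induction hp using Submodule.span_induction with
  | mem x h =>
    obtain ⟨l, hl, rfl⟩ := h
    have : (fun x => mono l (r • x)) = r ^ l.length • mono l := by
      ext x; simp [mono_homog]
    rw [this]
    exact (Pol n N).smul_mem _ (mono_mem hl)
  | zero =>
    exact (Pol n _).zero_mem
  | add p q _ _ h1 h2 => exact (Pol n _).add_mem h1 h2
  | smul a p _ h => exact (Pol n _).smul_mem a h

lemma mono_Aop {n : ℕ} (l : List (Fin n)) (x : EV n) :
    Aop (mono l) x = ‖x‖ ^ 2 * lap (mono l) x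
      - (l.length : ℝ) * ((n : ℝ) - 2 + l.length) * mono l x := by
  refine homog_Aop ((mono_contDiff l).of_le (by simp)) _ (fun s x => ?_) x
  rw [mono_homog, Real.exp_nat_mul]

def lamk (n k : ℕ) : ℝ := (k : ℝ) * ((n : ℝ) - 2 + k)

structure GoodFam {n m : ℕ} (Y : Fin m → EV n → ℝ) (k : Fin m → ℕ) : Prop where
  smooth : ∀ i, ContDiff ℝ 2 (Y i)
  orth : ∀ i j, ∫ σ, Y i σ * Y j σ ∂(sphMeasure n) = if i = j then 1 else 0
  eig : ∀ i σ, ‖σ‖ = 1 → Aop (Y i) σ = - lamk n (k i) * Y i σ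
  const : ∀ i, k i = 0 → ∃ c : ℝ, ∀ σ, ‖σ‖ = 1 → Y i σ = c

def InSp {n m : ℕ} (Y : Fin m → EV n → ℝ) (p : EV n → ℝ) : Prop :=
  ∃ c : Fin m → ℝ, ∀ σ, ‖σ‖ = 1 → p σ = ∑ i, c i * Y i σ

lemma GoodFam.coef {n m : ℕ} {Y : Fin m → EV n → ℝ} {k : Fin m → ℕ} (h : GoodFam Y k)
    {f : EV n → ℝ} {c : Fin m → ℝ} (hf : ∀ σ, ‖σ‖ = 1 → f σ = ∑ i, c i * Y i σ) (j : Fin m) :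
    ∫ σ, f σ * Y j σ ∂(sphMeasure n) = c j := by
  have hc := fun i => (h.smooth i).continuous
  rw [sph_congr (g := fun σ => ∑ i, c i * (Y i σ * Y j σ)) (fun σ hσ => by
    rw [hf σ hσ, Finset.sum_mul]; simp only [mul_assoc])]
  rw [integral_finsetSum _ fun i _ => sph_integrable (by fun_prop)]
  simp only [integral_const_mul, h.orth]
  simp

lemma gs_step {n m : ℕ} {Y : Fin m → EV n → ℝ} {k : Fin m → ℕ} (h : GoodFam Y k)
    {p : EV n → ℝ} (hp : ContDiff ℝ 2 p) (N : ℕ)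
    (hN : N = 0 → m = 0 ∧ ∃ c : ℝ, ∀ σ, ‖σ‖ = 1 → p σ = c)
    (hz : InSp Y (fun x => Aop p x + lamk n N * p x)) :
    ∃ (m' : ℕ) (Y' : Fin m' → EV n → ℝ) (k' : Fin m' → ℕ), GoodFam Y' k' ∧
      (∀ q, InSp Y q → InSp Y' q) ∧ InSp Y' p := by
  have hYc := fun i => (h.smooth i).continuous
  have hpc := hp.continuous
  set d : Fin m → ℝ := fun i => ∫ σ, p σ * Y i σ ∂(sphMeasure n) with hd
  set q : EV n → ℝ := fun x => p x + ∑ i, (- d i) * Y i x with hq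
  have hsum : ContDiff ℝ 2 (fun x => ∑ i, (- d i) * Y i x) :=
    ContDiff.sum fun i _ => contDiff_const.mul (h.smooth i)
  have hqs : ContDiff ℝ 2 q := hp.add hsum
  have hqc := hqs.continuous
  have hqY : ∀ j, ∫ σ, q σ * Y j σ ∂(sphMeasure n) = 0 := by
    intro j
    have e : ∀ σ, q σ * Y j σ = p σ * Y j σ + (∑ i, (- d i) * Y i σ) * Y j σ := fun σ => by
      simp only [hq]; ring
    simp only [e]
    rw [integral_add (sph_integrable (by fun_prop)) (sph_integrable (by fun_prop)),
      h.coef (c := fun i => - d i) (fun σ _ => rfl) j]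
    simp [hd]
  have hpq : ∀ σ, p σ = q σ + ∑ i, d i * Y i σ := fun σ => by simp [hq]
  set I := ∫ σ, (q σ) ^ 2 ∂(sphMeasure n) with hI
  have hI0 : 0 ≤ I := integral_nonneg fun σ => sq_nonneg _
  rcases hI0.eq_or_lt with hI1 | hI1
  · refine ⟨m, Y, k, h, fun q hq => hq, d, fun σ hσ => ?_⟩
    rw [hpq, sph_zero hqc hI1.symm σ hσ, zero_add]
  set a := (Real.sqrt I)⁻¹ with ha
  have ha2 : a * a * I = 1 := by
    have := Real.sq_sqrt hI0
    have h3 := (Real.sqrt_pos.2 hI1).ne'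
    rw [ha]
    field_simp
    exact this.symm
  have ha0 : a ≠ 0 := by
    intro h0; rw [h0] at ha2; simp at ha2
  set Z : EV n → ℝ := fun x => a * q x with hZ
  have hZs : ContDiff ℝ 2 Z := contDiff_const.mul hqs
  have hZc := hZs.continuous
  have hZY : ∀ j, ∫ σ, Z σ * Y j σ ∂(sphMeasure n) = 0 := by
    intro j
    simp only [hZ, mul_assoc, integral_const_mul, hqY, mul_zero]
  have hYZ : ∀ j, ∫ σ, Y j σ * Z σ ∂(sphMeasure n) = 0 := by
    intro j
    simp only [mul_comm (Y j _), hZY]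
  have hZZ : ∫ σ, Z σ * Z σ ∂(sphMeasure n) = 1 := by
    have e : ∀ σ, Z σ * Z σ = a * a * (q σ) ^ 2 := fun σ => by simp only [hZ]; ring
    simp only [e, integral_const_mul]
    exact ha2
  obtain ⟨c, hc⟩ := hz
  have hZA : ∀ σ, ‖σ‖ = 1 → Aop Z σ + lamk n N * Z σ
      = ∑ i, (a * (c i - d i * (lamk n N - lamk n (k i)))) * Y i σ := by
    intro σ hσ
    have e1 : Aop Z σ = a * (Aop p σ + ∑ i, (- d i) * Aop (Y i) σ) := by
      rw [hZ, Aop_cmul a hqs, hq, Aop_add hp hsum, Aop_sum _ _ h.smooth]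
    have e2 := hc σ hσ
    rw [e1]
    simp only [hZ, hq, h.eig _ σ hσ]
    have e3 : ∑ i, (a * (c i - d i * (lamk n N - lamk n (k i)))) * Y i σ
        = a * (∑ i, c i * Y i σ + (∑ i, (- d i) * (- lamk n (k i) * Y i σ)
          + lamk n N * ∑ i, (- d i) * Y i σ)) := by
      simp only [Finset.mul_sum, ← Finset.sum_add_distrib]
      refine Finset.sum_congr rfl fun i _ => by ring
    rw [e3, ← e2]
    ring
  have hZE : ∀ σ, ‖σ‖ = 1 → Aop Z σ = - lamk n N * Z σ := by
    have he : ∀ j, a * (c j - d j * (lamk n N - lamk n (k j))) = 0 := by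
      intro j
      have e := h.coef (f := fun σ => Aop Z σ + lamk n N * Z σ) hZA j
      rw [← e]
      have hAc := Aop_continuous hZs
      simp only [add_mul]
      rw [integral_add (sph_integrable (by fun_prop)) (sph_integrable (by fun_prop)),
        Aop_selfadj hZs (h.smooth j),
        sph_congr (g := fun σ => - lamk n (k j) * (Z σ * Y j σ))
          (fun σ hσ => by rw [h.eig j σ hσ]; ring)]
      simp only [mul_assoc, integral_const_mul, hZY]
      simp
    intro σ hσ
    have := hZA σ hσ
    simp only [he, zero_mul, Finset.sum_const_zero] at this
    linarith
  refine ⟨m + 1, Fin.cons Z Y, Fin.cons N k, ⟨?_, ?_, ?_, ?_⟩, ?_, ?_⟩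
  · intro i
    refine Fin.cases ?_ (fun i => ?_) i
    · simpa using hZs
    · simpa using h.smooth i
  · intro i j
    refine Fin.cases ?_ (fun i => ?_) i
    · refine Fin.cases ?_ (fun j => ?_) j
      · simpa using hZZ
      · simpa [(Fin.succ_ne_zero j).symm] using hZY j
    · refine Fin.cases ?_ (fun j => ?_) j
      · simpa using hYZ i
      · simpa using h.orth i j
  · intro i
    refine Fin.cases ?_ (fun i => ?_) i
    · simpa using hZE
    · simpa using h.eig i
  · intro i
    refine Fin.cases ?_ (fun i => ?_) i
    · intro h0
      obtain ⟨hm, c0, hc0⟩ := hN (by simpa using h0)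
      have : IsEmpty (Fin m) := by rw [hm]; infer_instance
      refine ⟨a * c0, fun σ hσ => ?_⟩
      simp [hZ, hq, hc0 σ hσ]
    · simpa using h.const i
  · rintro q ⟨c, hc⟩
    refine ⟨Fin.cons 0 c, fun σ hσ => ?_⟩
    simp [Fin.sum_univ_succ, hc σ hσ]
  · refine ⟨Fin.cons a⁻¹ d, fun σ hσ => ?_⟩
    simp only [Fin.sum_univ_succ, Fin.cons_zero, Fin.cons_succ]
    rw [hpq, hZ]
    field_simp

lemma InSp_of_Pol {n m N : ℕ} {Y : Fin m → EV n → ℝ}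
    (h : ∀ l : List (Fin n), l.length ≤ N → InSp Y (mono l)) {p : EV n → ℝ} (hp : p ∈ Pol n N) :
    InSp Y p := by
  induction hp using Submodule.span_induction with
  | mem x hx => obtain ⟨l, hl, rfl⟩ := hx; exact h l hl
  | zero => exact ⟨0, by simp⟩
  | add x y _ _ h1 h2 =>
    obtain ⟨c1, h1⟩ := h1
    obtain ⟨c2, h2⟩ := h2
    refine ⟨c1 + c2, fun σ hσ => ?_⟩
    simp [h1 σ hσ, h2 σ hσ, add_mul, Finset.sum_add_distrib]
  | smul a x _ h =>
    obtain ⟨c, h⟩ := h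
    refine ⟨a • c, fun σ hσ => ?_⟩
    simp [h σ hσ, Finset.mul_sum, mul_assoc]

lemma harm_aux (n N : ℕ) : ∃ (m : ℕ) (Y : Fin m → EV n → ℝ) (k : Fin m → ℕ), GoodFam Y k ∧
    ∀ l : List (Fin n), l.length ≤ N → InSp Y (mono l) := by
  induction N with
  | zero =>
    have h0 : GoodFam (n := n) (m := 0) (fun _ _ => 0) (fun _ => 0) :=
      ⟨fun i => i.elim0, fun i => i.elim0, fun i => i.elim0, fun i => i.elim0⟩
    obtain ⟨m, Y, k, h1, _, h3⟩ := gs_step h0 (p := mono []) ((mono_contDiff []).of_le (by simp)) 0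
      (fun _ => ⟨rfl, 1, fun σ _ => by simp [mono_nil]⟩)
      ⟨0, fun σ _ => by
        simp only [mono_Aop, lamk]
        rw [lap_eq' ((mono_contDiff []).of_le (by simp))]
        simp [mono_nil]⟩
    refine ⟨m, Y, k, h1, fun l hl => ?_⟩
    have : l = [] := by simpa using hl
    rw [this]; exact h3
  | succ N ih =>
    have hfin : {l : List (Fin n) | l.length = N + 1}.Finite := List.finite_length_eq _ _
    have key : ∀ s : Finset (List (Fin n)), (∀ l ∈ s, l.length = N + 1) →
        ∃ (m : ℕ) (Y : Fin m → EV n → ℝ) (k : Fin m → ℕ), GoodFam Y k ∧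
        (∀ l : List (Fin n), l.length ≤ N → InSp Y (mono l)) ∧ ∀ l ∈ s, InSp Y (mono l) := by
      intro s
      induction s using Finset.induction_on with
      | empty =>
        intro _
        obtain ⟨m, Y, k, h1, h2⟩ := ih
        exact ⟨m, Y, k, h1, h2, by simp⟩
      | insert l s _ ih2 =>
        intro hs
        obtain ⟨m, Y, k, h1, h2, h3⟩ := ih2 fun l hl => hs l (Finset.mem_insert_of_mem hl)
        have hl := hs l (Finset.mem_insert_self _ _)
        obtain ⟨m', Y', k', g1, g2, g3⟩ := gs_step h1 (p := mono l)
          ((mono_contDiff l).of_le (by simp)) (N + 1) (fun h => by omega) (by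
            have hpol : lap (mono l) ∈ Pol n N := by
              simpa using Pol_lap (mono_mem (n := n) (N := N + 1) hl.le)
            obtain ⟨c, hc⟩ := InSp_of_Pol h2 hpol
            refine ⟨c, fun σ hσ => ?_⟩
            rw [← hc σ hσ]
            show Aop (mono l) σ + lamk n (N+1) * mono l σ = _
            rw [mono_Aop, hl, hσ, lamk]
            push_cast
            ring)
        refine ⟨m', Y', k', g1, fun l hl => g2 _ (h2 l hl), fun l' hl' => ?_⟩
        rcases Finset.mem_insert.1 hl' with rfl | h
        · exact g3
        · exact g2 _ (h3 l' h)
    obtain ⟨m, Y, k, h1, h2, h3⟩ := key hfin.toFinset (fun l hl => by simpa using hl)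
    refine ⟨m, Y, k, h1, fun l hl => ?_⟩
    rcases Nat.le_succ_iff.1 hl with h | h
    · exact h2 l h
    · exact h3 l (by simpa using h)

lemma harm_exists (n N : ℕ) : ∃ (m : ℕ) (Y : Fin m → EV n → ℝ) (k : Fin m → ℕ), GoodFam Y k ∧
    ∀ p ∈ Pol n N, InSp Y p := by
  obtain ⟨m, Y, k, h1, h2⟩ := harm_aux n N
  exact ⟨m, Y, k, h1, fun p hp => InSp_of_Pol h2 hp⟩

/-- Parseval defect identity -/
lemma parseval {n m : ℕ} {Y : Fin m → EV n → ℝ} {k : Fin m → ℕ} (h : GoodFam Y k)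
    {v : EV n → ℝ} (hv : Continuous v) (c : Fin m → ℝ) :
    ∫ σ, (v σ - ∑ i, c i * Y i σ) ^ 2 ∂(sphMeasure n)
      = ∫ σ, (v σ) ^ 2 ∂(sphMeasure n) - ∑ i, (∫ σ, v σ * Y i σ ∂(sphMeasure n)) ^ 2
        + ∑ i, (c i - ∫ σ, v σ * Y i σ ∂(sphMeasure n)) ^ 2 := by
  have hYc := fun i => (h.smooth i).continuous
  have e : ∀ σ, (v σ - ∑ i, c i * Y i σ) ^ 2 = (v σ) ^ 2 - ∑ i, (2 * c i) * (v σ * Y i σ)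
      + ∑ j, c j * ((∑ i, c i * Y i σ) * Y j σ) := by
    intro σ
    have e1 : ∑ i, (2 * c i) * (v σ * Y i σ) = 2 * v σ * ∑ i, c i * Y i σ := by
      rw [Finset.mul_sum]; refine Finset.sum_congr rfl fun i _ => by ring
    have e2 : ∑ j, c j * ((∑ i, c i * Y i σ) * Y j σ) = (∑ i, c i * Y i σ) * ∑ i, c i * Y i σ := by
      conv_rhs => rw [Finset.mul_sum]
      refine Finset.sum_congr rfl fun i _ => by ring
    rw [e1, e2]; ring
  simp only [e]
  rw [integral_add (sph_integrable (by fun_prop)) (sph_integrable (by fun_prop)),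
    integral_sub (sph_integrable (by fun_prop)) (sph_integrable (by fun_prop)),
    integral_finsetSum _ fun i _ => sph_integrable (by fun_prop),
    integral_finsetSum _ fun i _ => sph_integrable (by fun_prop)]
  simp only [integral_const_mul]
  simp only [h.coef (c := c) (fun σ _ => rfl)]
  rw [sub_add, sub_add, ← Finset.sum_sub_distrib, ← Finset.sum_sub_distrib]
  congr 1
  refine Finset.sum_congr rfl fun i _ => by ring

lemma oneD {w w1 w2 : ℝ → ℝ} (h1 : ∀ s, HasDerivAt w (w1 s) s) (h2 : ∀ s, HasDerivAt w1 (w2 s) s)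
    (hc : Continuous w2) (hs : HasCompactSupport w) (b g : ℝ) :
    ∫ s, (w2 s + b * w1 s - g * w s) ^ 2
      = (∫ s, (w2 s) ^ 2) + (b ^ 2 + 2 * g) * (∫ s, (w1 s) ^ 2) + g ^ 2 * ∫ s, (w s) ^ 2 := by
  have e1 : deriv w = w1 := funext fun s => (h1 s).deriv
  have e2 : deriv w1 = w2 := funext fun s => (h2 s).deriv
  have s1 : HasCompactSupport w1 := e1 ▸ hs.deriv
  have s2 : HasCompactSupport w2 := e2 ▸ s1.deriv
  have c0 : Continuous w := continuous_iff_continuousAt.2 fun s => (h1 s).continuousAt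
  have c1 : Continuous w1 := continuous_iff_continuousAt.2 fun s => (h2 s).continuousAt
  have hd : ∀ s, HasDerivAt (fun s => b * (w1 s) ^ 2 - 2 * g * (w s * w1 s) - b * g * (w s) ^ 2)
      (2 * b * (w1 s * w2 s) - 2 * g * (w1 s * w1 s + w s * w2 s) - 2 * b * g * (w s * w1 s)) s := by
    intro s
    have a := ((((h2 s).pow 2).const_mul b).sub (((h1 s).mul (h2 s)).const_mul (2 * g))).sub
      (((h1 s).pow 2).const_mul (b * g))
    refine a.congr_deriv ?_
    simp
    ring
  have i0 : Integrable fun s => (w s) ^ 2 := by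
    simp only [sq]; exact (c0.mul c0).integrable_of_hasCompactSupport hs.mul_left
  have i1 : Integrable fun s => (w1 s) ^ 2 := by
    simp only [sq]; exact (c1.mul c1).integrable_of_hasCompactSupport s1.mul_left
  have i2 : Integrable fun s => (w2 s) ^ 2 := by
    simp only [sq]; exact (hc.mul hc).integrable_of_hasCompactSupport s2.mul_left
  have i01 : Integrable fun s => w s * w1 s :=
    (c0.mul c1).integrable_of_hasCompactSupport s1.mul_left
  have i02 : Integrable fun s => w s * w2 s :=
    (c0.mul hc).integrable_of_hasCompactSupport s2.mul_left
  have i12 : Integrable fun s => w1 s * w2 s :=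
    (c1.mul hc).integrable_of_hasCompactSupport s2.mul_left
  have i11 : Integrable fun s => w1 s * w1 s :=
    (c1.mul c1).integrable_of_hasCompactSupport s1.mul_left
  have iD : Integrable fun s => 2 * b * (w1 s * w2 s) - 2 * g * (w1 s * w1 s + w s * w2 s)
      - 2 * b * g * (w s * w1 s) :=
    ((i12.const_mul _).sub ((i11.add i02).const_mul _)).sub (i01.const_mul _)
  have z := integral_eq_zero_of_hasDerivAt_of_integrable hd iD
    (((i1.const_mul b).sub (i01.const_mul (2 * g))).sub (i0.const_mul (b * g)))
  have e : ∀ s, (w2 s + b * w1 s - g * w s) ^ 2 = ((w2 s) ^ 2 + (b ^ 2 + 2 * g) * (w1 s) ^ 2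
      + g ^ 2 * (w s) ^ 2) + (2 * b * (w1 s * w2 s) - 2 * g * (w1 s * w1 s + w s * w2 s)
      - 2 * b * g * (w s * w1 s)) := fun s => by ring
  simp only [e]
  have j1 : Integrable fun s => (w2 s) ^ 2 + (b ^ 2 + 2 * g) * (w1 s) ^ 2 := i2.add (i1.const_mul _)
  have j2 : Integrable fun s => (w2 s) ^ 2 + (b ^ 2 + 2 * g) * (w1 s) ^ 2 + g ^ 2 * (w s) ^ 2 :=
    j1.add (i0.const_mul _)
  rw [integral_add j2 iD, z, add_zero, integral_add j1 (i0.const_mul _),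
    integral_add i2 (i1.const_mul _), integral_const_mul, integral_const_mul]

/-- weighted version -/
lemma oneD_w {f f1 f2 : ℝ → ℝ} (h1 : ∀ s, HasDerivAt f (f1 s) s) (h2 : ∀ s, HasDerivAt f1 (f2 s) s)
    (hc : Continuous f2) (hs : HasCompactSupport f) (n : ℕ) (α lam : ℝ) (hl : 0 ≤ lam) :
    (gam n α + lam) ^ 2 * (∫ s, Real.exp ((α + n - 4) * s) * (f s) ^ 2) ≤
    ∫ s, Real.exp ((α + n - 4) * s) * (f2 s + ((n : ℝ) - 2) * f1 s - lam * f s) ^ 2 := by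
  set κ : ℝ := (α + n - 4) / 2 with hκ
  set E : ℝ → ℝ := fun s => Real.exp (κ * s) with hE
  have hEd : ∀ s, HasDerivAt E (κ * E s) s := by
    intro s
    have := ((hasDerivAt_id s).const_mul κ).exp
    refine this.congr_deriv ?_
    simp [hE]; ring
  have hEc : Continuous E := by fun_prop
  have c0 : Continuous f := continuous_iff_continuousAt.2 fun s => (h1 s).continuousAt
  have c1 : Continuous f1 := continuous_iff_continuousAt.2 fun s => (h2 s).continuousAt
  have d1 : ∀ s, HasDerivAt (fun s => E s * f s) (E s * (f1 s + κ * f s)) s := fun s =>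
    ((hEd s).mul (h1 s)).congr_deriv (by ring)
  have d2 : ∀ s, HasDerivAt (fun s => E s * (f1 s + κ * f s))
      (E s * (f2 s + 2 * κ * f1 s + κ ^ 2 * f s)) s := fun s =>
    ((hEd s).mul ((h2 s).add ((h1 s).const_mul κ))).congr_deriv (by simp; ring)
  have key := oneD d1 d2 (by fun_prop) hs.mul_left (2 - α) (gam n α + lam)
  have hsq : ∀ s, Real.exp ((α + n - 4) * s) = E s ^ 2 := by
    intro s
    rw [hE, ← Real.exp_nat_mul]
    congr 1
    simp [hκ]; ring
  have e1 : ∀ s, Real.exp ((α + n - 4) * s) * (f2 s + ((n : ℝ) - 2) * f1 s - lam * f s) ^ 2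
      = (E s * (f2 s + 2 * κ * f1 s + κ ^ 2 * f s) + (2 - α) * (E s * (f1 s + κ * f s))
        - (gam n α + lam) * (E s * f s)) ^ 2 := by
    intro s
    rw [hsq, hκ, gam]; ring
  have e2 : ∀ s, Real.exp ((α + n - 4) * s) * (f s) ^ 2 = (E s * f s) ^ 2 := by
    intro s
    rw [hsq]; ring
  simp only [e1, e2]
  rw [key]
  have p1 : 0 ≤ (2 - α) ^ 2 + 2 * (gam n α + lam) := by
    rw [gam]; nlinarith [sq_nonneg ((n : ℝ) - 2), sq_nonneg (α - 2)]
  have p2 : 0 ≤ ∫ s, (E s * (f1 s + κ * f s)) ^ 2 := integral_nonneg fun s => sq_nonneg _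
  have p3 : 0 ≤ ∫ s, (E s * (f2 s + 2 * κ * f1 s + κ ^ 2 * f s)) ^ 2 :=
    integral_nonneg fun s => sq_nonneg _
  nlinarith [mul_nonneg p1 p2]

lemma Lop_scale {n : ℕ} (J : EV n →L[ℝ] EV n) (v : EV n → ℝ) (r : ℝ) :
    Lop J (fun x => v (r • x)) = fun x => Lop J v (r • x) := by
  ext x
  unfold Lop
  have := fderiv_comp_smul (𝕜 := ℝ) (f := v) (x := x) r
  rw [this]
  simp

lemma Aop_scale {n : ℕ} {v : EV n → ℝ} (hv : ContDiff ℝ 2 v) (r : ℝ) (x : EV n) :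
    Aop (fun x => v (r • x)) x = Aop v (r • x) := by
  have h2 : ContDiff ℝ 2 (fun x => v (r • x)) := hv.comp (contDiff_const_smul r)
  rw [Aop_eq h2, Aop_eq hv]
  simp only [Lop_scale]

lemma lap_continuous {n : ℕ} {v : EV n → ℝ} (hv : ContDiff ℝ 2 v) : Continuous (lap v) := by
  unfold lap
  have := hv.continuous_iteratedFDeriv (m := 2) le_rfl
  fun_prop

lemma lap_tsupport {n : ℕ} (v : EV n → ℝ) : tsupport (lap v) ⊆ tsupport v := by
  have h2 : Function.support (lap v) ⊆ tsupport v := by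
    intro x hx
    by_contra h
    apply hx
    have h3 : iteratedFDeriv ℝ 2 v x = 0 := by
      by_contra h4
      exact h (support_iteratedFDeriv_subset (𝕜 := ℝ) (f := v) 2 h4)
    simp [lap, h3]
  exact closure_minimal h2 (isClosed_tsupport v)

lemma pol_approx {n : ℕ} {u : EV n → ℝ} (hu : Continuous u) (R ε : ℝ) (hε : 0 < ε) :
    ∃ N, ∃ p ∈ Pol n N, ∀ x, ‖x‖ ≤ R → |u x - p x| < ε := by
  let A : Subalgebra ℝ C(EV n, ℝ) :=
    { carrier := {f | ∃ N, (f : EV n → ℝ) ∈ Pol n N}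
      mul_mem' := by
        rintro f g ⟨N, hf⟩ ⟨M, hg⟩
        exact ⟨N + M, Pol_mul hf hg⟩
      add_mem' := by
        rintro f g ⟨N, hf⟩ ⟨M, hg⟩
        exact ⟨max N M, (Pol n _).add_mem (Pol_mono (le_max_left _ _) hf)
          (Pol_mono (le_max_right _ _) hg)⟩
      algebraMap_mem' := by
        intro r
        refine ⟨0, ?_⟩
        have : ((algebraMap ℝ C(EV n, ℝ) r : C(EV n, ℝ)) : EV n → ℝ) = r • mono [] := by
          ext x; simp [mono_nil, Algebra.algebraMap_eq_smul_one]
        rw [this]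
        exact (Pol n 0).smul_mem _ (mono_mem (by simp)) }
  have hA : A.SeparatesPoints := by
    intro x y hxy
    have : ∃ i, x i ≠ y i := by
      by_contra h
      push Not at h
      exact hxy (PiLp.ext h)
    obtain ⟨i, hi⟩ := this
    refine ⟨fun x => x i, ⟨⟨fun x => x i, by fun_prop⟩, ⟨1, ?_⟩, rfl⟩, hi⟩
    have := mono_mem (n := n) (N := 1) (l := [i]) (by simp)
    simpa [mono_cons, mono_nil] using this
  obtain ⟨g, ⟨N, hg⟩, h⟩ :=
    ContinuousMap.exists_mem_subalgebra_near_continuous_of_isCompact_of_separatesPoints hA ⟨u, hu⟩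
      (isCompact_closedBall (0 : EV n) R) hε
  refine ⟨N, g, hg, fun x hx => ?_⟩
  rw [abs_sub_comm]
  exact h x (by simpa using hx)

lemma wcont {n : ℕ} {g : EV n → ℝ} (hg : Continuous g) (hs : tsupport g ⊆ {(0 : EV n)}ᶜ) (a : ℝ) :
    Continuous (fun x => ‖x‖ ^ a * g x) := by
  rw [continuous_iff_continuousAt]
  intro x
  by_cases hx : x = 0
  · have h0 : x ∉ tsupport g := fun h => hs h hx
    have : (fun x => ‖x‖ ^ a * g x) =ᶠ[nhds x] fun _ => 0 := by
      filter_upwards [notMem_tsupport_iff_eventuallyEq.1 h0] with y hy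
      simp [hy]
    exact (continuousAt_congr this).2 continuousAt_const
  · refine ContinuousAt.mul ?_ hg.continuousAt
    exact continuous_norm.continuousAt.rpow_const (Or.inl (by simpa using hx))

lemma polar_w {n : ℕ} (hn : 2 ≤ n) {g : EV n → ℝ} (hg : Continuous g) (hc : HasCompactSupport g)
    (hs : tsupport g ⊆ {(0 : EV n)}ᶜ) (a : ℝ) :
    ∫ x, ‖x‖ ^ a * (g x) ^ 2
      = ∫ s, Real.exp ((a + n) * s) * ∫ σ, (g (Real.exp s • σ)) ^ 2 ∂(sphMeasure n) := by
  have hi : Integrable (fun x => ‖x‖ ^ a * (g x) ^ 2) := by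
    have := ((wcont hg hs a).mul hg).integrable_of_hasCompactSupport (μ := volume) hc.mul_left
    refine this.congr (Eventually.of_forall fun x => ?_)
    show ‖x‖ ^ a * g x * g x = ‖x‖ ^ a * (g x) ^ 2
    ring
  rw [polar_log hn hi]
  congr 1
  ext s
  rw [sph_congr (g := fun σ => Real.exp (a * s) * (g (Real.exp s • σ)) ^ 2) (fun σ hσ => by
    rw [norm_smul, hσ, mul_one, Real.norm_eq_abs, Real.abs_exp, ← Real.exp_mul, mul_comm s]),
    integral_const_mul, ← mul_assoc, ← Real.exp_add]
  ring_nf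

lemma supp_log {n : ℕ} {u : EV n → ℝ} (hc : HasCompactSupport u)
    (hs : tsupport u ⊆ {(0 : EV n)}ᶜ) :
    ∃ S : ℝ, ∀ s σ, ‖σ‖ = 1 → Real.exp s • σ ∈ tsupport u → s ∈ Icc (-S) S := by
  have hK : IsCompact (tsupport u) := hc
  have hcont : ContinuousOn (fun x : EV n => Real.log ‖x‖) (tsupport u) :=
    continuous_norm.continuousOn.log fun x hx => by simpa using hs hx
  obtain ⟨S, hS⟩ := hK.exists_bound_of_continuousOn hcont
  refine ⟨S, fun s σ hσ h => ?_⟩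
  have := hS _ h
  rw [norm_smul, hσ, mul_one, Real.norm_eq_abs, Real.norm_eq_abs, Real.abs_exp, Real.log_exp] at this
  exact abs_le.1 this

lemma coef_ode {n : ℕ} {u Y : EV n → ℝ} (hu : ContDiff ℝ 2 u) (hY : ContDiff ℝ 2 Y) {lam : ℝ}
    (he : ∀ σ, ‖σ‖ = 1 → Aop Y σ = - lam * Y σ) :
    ∃ f1 f2 : ℝ → ℝ,
      (∀ s, HasDerivAt (fun s => ∫ σ, u (Real.exp s • σ) * Y σ ∂(sphMeasure n)) (f1 s) s) ∧
      (∀ s, HasDerivAt f1 (f2 s) s) ∧ Continuous f2 ∧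
      ∀ s, ∫ σ, (Real.exp (2 * s) * lap u (Real.exp s • σ)) * Y σ ∂(sphMeasure n)
        = f2 s + ((n : ℝ) - 2) * f1 s - lam * ∫ σ, u (Real.exp s • σ) * Y σ ∂(sphMeasure n) := by
  have hYc := hY.continuous
  have huc := hu.continuous
  have hD1 : Continuous (fderiv ℝ u) := hu.continuous_fderiv (by norm_num)
  have hD2 : Continuous (fderiv ℝ (fderiv ℝ u)) :=
    (hu.fderiv_right (m := 1) (by norm_num)).continuous_fderiv (by norm_num)
  set G1 : ℝ → EV n → ℝ := fun s σ => fderiv ℝ u (Real.exp s • σ) (Real.exp s • σ) * Y σ with hG1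
  set G2 : ℝ → EV n → ℝ := fun s σ =>
    (fderiv ℝ (fderiv ℝ u) (Real.exp s • σ) (Real.exp s • σ) (Real.exp s • σ)
        + fderiv ℝ u (Real.exp s • σ) (Real.exp s • σ)) * Y σ with hG2
  have c0 : Continuous (Function.uncurry fun s σ => u (Real.exp s • σ) * Y σ) := by
    unfold Function.uncurry; fun_prop
  have c1 : Continuous (Function.uncurry G1) := by
    simp only [hG1]
    unfold Function.uncurry; fun_prop
  have c2 : Continuous (Function.uncurry G2) := by
    simp only [hG2]
    unfold Function.uncurry; fun_prop
  refine ⟨fun s => ∫ σ, G1 s σ ∂(sphMeasure n), fun s => ∫ σ, G2 s σ ∂(sphMeasure n), ?_, ?_, ?_, ?_⟩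
  · exact sph_deriv c0 c1 fun s σ _ => (ray1 hu σ s).mul_const _
  · exact sph_deriv c1 c2 fun s σ _ => (ray2 hu σ s).mul_const _
  · exact sph_continuous c2
  · intro s
    have hA := Aop_selfadj (hu.comp (contDiff_const_smul (Real.exp s))) hY
    have hAc : Continuous (Aop u) := Aop_continuous hu
    have hA' : ∫ σ, Aop u (Real.exp s • σ) * Y σ ∂(sphMeasure n)
        = - lam * ∫ σ, u (Real.exp s • σ) * Y σ ∂(sphMeasure n) := by
      rw [← integral_const_mul]
      have e : ∀ σ, Aop (u ∘ fun x => Real.exp s • x) σ = Aop u (Real.exp s • σ) :=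
        fun σ => Aop_scale hu _ σ
      simp only [e] at hA
      rw [hA]
      refine sph_congr fun σ hσ => ?_
      rw [he σ hσ]
      simp only [Function.comp]; ring
    have i1 : Integrable (fun σ => G1 s σ) (sphMeasure n) :=
      sph_integrable (by simp only [hG1]; fun_prop)
    have i2 : Integrable (fun σ => G2 s σ) (sphMeasure n) :=
      sph_integrable (by simp only [hG2]; fun_prop)
    have i3 : Integrable (fun σ => Aop u (Real.exp s • σ) * Y σ) (sphMeasure n) :=
      sph_integrable (by fun_prop)
    have i12 : Integrable (fun σ => G2 s σ + ((n : ℝ) - 2) * G1 s σ) (sphMeasure n) :=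
      i2.add (i1.const_mul _)
    rw [sub_eq_add_neg, ← neg_mul, ← hA', ← integral_const_mul,
      ← integral_add i2 (i1.const_mul _), ← integral_add i12 i3]
    refine sph_congr fun σ hσ => ?_
    have hnorm : ‖Real.exp s • σ‖ ^ 2 = Real.exp (2 * s) := by
      rw [norm_smul, hσ, mul_one, Real.norm_eq_abs, Real.abs_exp, ← Real.exp_nat_mul]
      norm_num
    simp only [hG1, hG2, Aop, hnorm]
    ring

lemma lamk_nonneg {n : ℕ} (hn : 2 ≤ n) (k : ℕ) : 0 ≤ lamk n k := by
  unfold lamk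
  have : (2 : ℝ) ≤ n := by exact_mod_cast hn
  have : (0 : ℝ) ≤ k := Nat.cast_nonneg k
  nlinarith

lemma lower_eps {n : ℕ} (hn : 2 ≤ n) (α : ℝ) {u : EV n → ℝ} (hu : ContDiff ℝ 2 u)
    (hc : HasCompactSupport u) (hs : tsupport u ⊆ {(0 : EV n)}ᶜ)
    (h0 : ∀ r : ℝ, 0 < r → (∫ σ, u (r • σ) ∂(sphMeasure n)) = 0)
    {M : ℝ} (hM0 : 0 ≤ M) (hM : ∀ k : ℕ, 1 ≤ k → M ≤ (gam n α + lamk n k) ^ 2)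
    {S : ℝ} (hS : ∀ s σ, ‖σ‖ = 1 → Real.exp s • σ ∈ tsupport u → s ∈ Icc (-S) S)
    {ε : ℝ} (hε : 0 < ε) :
    M * (∫ s, Real.exp ((α + n - 4) * s) * ∫ σ, (u (Real.exp s • σ)) ^ 2 ∂(sphMeasure n)) ≤
    (∫ s, Real.exp ((α + n - 4) * s) *
      ∫ σ, (Real.exp (2 * s) * lap u (Real.exp s • σ)) ^ 2 ∂(sphMeasure n))
      + ε ^ 2 * (M * (∫ σ, (1:ℝ) ∂(sphMeasure n)) * ∫ s in Icc (-S) S, Real.exp ((α + n - 4) * s)) := by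
  have huc := hu.continuous
  have hlc := lap_continuous hu
  set E : ℝ → ℝ := fun s => Real.exp ((α + n - 4) * s) with hE
  have hEc : Continuous E := by fun_prop
  have hE0 : ∀ s, 0 ≤ E s := fun s => (Real.exp_pos _).le
  obtain ⟨N, p, hp, hpu⟩ := pol_approx huc (Real.exp S) ε hε
  obtain ⟨m, Y, k, hG, hsp⟩ := harm_exists n N
  have hYc := fun i => (hG.smooth i).continuous
  set f : Fin m → ℝ → ℝ := fun j s => ∫ σ, u (Real.exp s • σ) * Y j σ ∂(sphMeasure n) with hf
  set F : Fin m → ℝ → ℝ := fun j s =>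
    ∫ σ, (Real.exp (2 * s) * lap u (Real.exp s • σ)) * Y j σ ∂(sphMeasure n) with hF
  set P : ℝ → ℝ := fun s => ∫ σ, (Real.exp (2 * s) * lap u (Real.exp s • σ)) ^ 2 ∂(sphMeasure n)
    with hP
  set Q : ℝ → ℝ := fun s => ∫ σ, (u (Real.exp s • σ)) ^ 2 ∂(sphMeasure n) with hQ
  set V : ℝ := ∫ σ, (1:ℝ) ∂(sphMeasure n) with hV
  have hu0 : ∀ s σ, s ∉ Icc (-S) S → ‖σ‖ = 1 → u (Real.exp s • σ) = 0 := fun s σ h hσ => by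
    by_contra h'
    exact h (hS s σ hσ (subset_tsupport u h'))
  have hl0 : ∀ s σ, s ∉ Icc (-S) S → ‖σ‖ = 1 → lap u (Real.exp s • σ) = 0 := fun s σ h hσ => by
    by_contra h'
    exact h (hS s σ hσ (lap_tsupport u (subset_tsupport _ h')))
  have zint : ∀ {φ : EV n → ℝ}, (∀ σ, ‖σ‖ = 1 → φ σ = 0) → ∫ σ, φ σ ∂(sphMeasure n) = 0 := by
    intro φ h
    rw [sph_congr (g := fun _ => 0) h]; simp
  have f0 : ∀ j s, s ∉ Icc (-S) S → f j s = 0 := fun j s h => zint fun σ hσ => by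
    rw [hu0 s σ h hσ, zero_mul]
  have F0 : ∀ j s, s ∉ Icc (-S) S → F j s = 0 := fun j s h => zint fun σ hσ => by
    rw [hl0 s σ h hσ]; ring
  have P0 : ∀ s, s ∉ Icc (-S) S → P s = 0 := fun s h => zint fun σ hσ => by
    rw [hl0 s σ h hσ]; ring
  have Q0 : ∀ s, s ∉ Icc (-S) S → Q s = 0 := fun s h => zint fun σ hσ => by
    rw [hu0 s σ h hσ]; ring
  have csupp : ∀ {g : ℝ → ℝ}, (∀ s, s ∉ Icc (-S) S → g s = 0) → HasCompactSupport g :=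
    fun h => HasCompactSupport.intro isCompact_Icc (fun s hs => h s hs)
  have fc : ∀ j, Continuous (f j) := fun j => sph_continuous (by unfold Function.uncurry; fun_prop)
  have Fc : ∀ j, Continuous (F j) := fun j => sph_continuous (by unfold Function.uncurry; fun_prop)
  have Pc : Continuous P := sph_continuous (by unfold Function.uncurry; fun_prop)
  have Qc : Continuous Q := sph_continuous (by unfold Function.uncurry; fun_prop)
  have wint : ∀ {g : ℝ → ℝ}, Continuous g → (∀ s, s ∉ Icc (-S) S → g s = 0) →
      Integrable (fun s => E s * g s) := fun h h' =>
    (hEc.mul h).integrable_of_hasCompactSupport (csupp h').mul_left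
  have fi : ∀ j, Integrable (fun s => E s * (f j s) ^ 2) := fun j =>
    wint ((fc j).pow 2) fun s h => by simp [f0 j s h]
  have Fi : ∀ j, Integrable (fun s => E s * (F j s) ^ 2) := fun j =>
    wint ((Fc j).pow 2) fun s h => by simp [F0 j s h]
  -- each mode
  have mode : ∀ j, M * (∫ s, E s * (f j s) ^ 2) ≤ ∫ s, E s * (F j s) ^ 2 := by
    intro j
    rcases Nat.eq_zero_or_pos (k j) with hk | hk
    · obtain ⟨c, hcc⟩ := hG.const j hk
      have : ∀ s, f j s = 0 := by
        intro s
        simp only [hf]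
        rw [sph_congr (g := fun σ => u (Real.exp s • σ) * c) (fun σ hσ => by rw [hcc σ hσ]),
          integral_mul_const, h0 _ (Real.exp_pos s), zero_mul]
      simp only [this]
      simp
      exact integral_nonneg fun s => mul_nonneg (hE0 s) (sq_nonneg _)
    · obtain ⟨f1, f2, d1, d2, c2, hode⟩ := coef_ode hu (hG.smooth j) (hG.eig j)
      have := oneD_w (f := f j) d1 d2 c2 (csupp (f0 j)) n α (lamk n (k j)) (lamk_nonneg hn _)
      have e : ∀ s, F j s = f2 s + ((n : ℝ) - 2) * f1 s - lamk n (k j) * f j s := hode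
      simp only [e]
      refine le_trans ?_ this
      refine mul_le_mul_of_nonneg_right (hM _ hk)
        (integral_nonneg fun s => mul_nonneg (hE0 s) (sq_nonneg _))
  -- Bessel
  have bessel : ∀ s, ∑ j, (F j s) ^ 2 ≤ P s := by
    intro s
    have := parseval hG (v := fun σ => Real.exp (2 * s) * lap u (Real.exp s • σ)) (by fun_prop)
      (fun j => F j s)
    have h2 : 0 ≤ ∫ σ, (Real.exp (2 * s) * lap u (Real.exp s • σ) - ∑ i, F i s * Y i σ) ^ 2
      ∂(sphMeasure n) := integral_nonneg fun s => sq_nonneg _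
    rw [this] at h2
    simp only [hF, sub_self] at h2
    simp at h2
    exact h2
  -- approximation
  have approx : ∀ s, Q s ≤ ∑ j, (f j s) ^ 2 + (Icc (-S) S).indicator (fun _ => ε ^ 2 * V) s := by
    intro s
    by_cases h : s ∈ Icc (-S) S
    · rw [indicator_of_mem h]
      obtain ⟨c, hcc⟩ := hsp _ (Pol_scale (Real.exp s) hp)
      have e := parseval hG (v := fun σ => u (Real.exp s • σ)) (by fun_prop) c
      have h2 : ∫ σ, (u (Real.exp s • σ) - ∑ i, c i * Y i σ) ^ 2 ∂(sphMeasure n) ≤ ε ^ 2 * V := by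
        rw [hV, ← integral_const_mul]
        refine integral_mono_ae (sph_integrable (by fun_prop)) (sph_integrable (by fun_prop)) ?_
        filter_upwards [sph_ae n] with σ hσ
        rw [← hcc σ hσ, mul_one]
        have := hpu (Real.exp s • σ) (by
          rw [norm_smul, hσ, mul_one, Real.norm_eq_abs, Real.abs_exp]
          exact Real.exp_le_exp.2 h.2)
        exact sq_le_sq' (by linarith [(abs_lt.1 this).1]) (abs_lt.1 this).2.le
      rw [e] at h2
      have h3 : 0 ≤ ∑ i, (c i - f i s) ^ 2 := Finset.sum_nonneg fun i _ => sq_nonneg _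
      simp only [hQ, hf] at *
      linarith
    · rw [indicator_of_notMem h, Q0 s h, add_zero]
      exact Finset.sum_nonneg fun i _ => sq_nonneg _
  have sf : Integrable (fun s => ∑ j, E s * (f j s) ^ 2) := integrable_finsetSum _ fun j _ => fi j
  have sF : Integrable (fun s => ∑ j, E s * (F j s) ^ 2) := integrable_finsetSum _ fun j _ => Fi j
  have iE : IntegrableOn (fun s => (ε ^ 2 * V) * E s) (Icc (-S) S) :=
    (hEc.const_mul _).integrableOn_Icc
  have step1 : ∫ s, E s * Q s ≤ (∑ j, ∫ s, E s * (f j s) ^ 2) + (ε ^ 2 * V) * ∫ s in Icc (-S) S, E s := by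
    rw [← integral_finsetSum _ fun j _ => fi j, ← integral_const_mul,
      ← integral_indicator measurableSet_Icc,
      ← integral_add sf (iE.integrable_indicator measurableSet_Icc)]
    refine integral_mono (wint Qc Q0) (sf.add (iE.integrable_indicator measurableSet_Icc)) fun s => ?_
    have := mul_le_mul_of_nonneg_left (approx s) (hE0 s)
    refine this.trans (le_of_eq ?_)
    rw [mul_add, Finset.mul_sum]
    congr 1
    by_cases h : s ∈ Icc (-S) S
    · rw [indicator_of_mem h, indicator_of_mem h]; ring
    · rw [indicator_of_notMem h, indicator_of_notMem h]; ring
  have step2 : ∑ j, ∫ s, E s * (F j s) ^ 2 ≤ ∫ s, E s * P s := by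
    rw [← integral_finsetSum _ fun j _ => Fi j]
    refine integral_mono sF (wint Pc P0) fun s => ?_
    show ∑ j, E s * (F j s) ^ 2 ≤ _
    rw [← Finset.mul_sum]
    exact mul_le_mul_of_nonneg_left (bessel s) (hE0 s)
  calc M * ∫ s, E s * Q s ≤ M * ((∑ j, ∫ s, E s * (f j s) ^ 2)
        + (ε ^ 2 * V) * ∫ s in Icc (-S) S, E s) := mul_le_mul_of_nonneg_left step1 hM0
    _ = (∑ j, M * ∫ s, E s * (f j s) ^ 2) + ε ^ 2 * (M * V * ∫ s in Icc (-S) S, E s) := by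
      rw [← Finset.mul_sum]; ring
    _ ≤ _ := by
      have := Finset.sum_le_sum fun j (_ : j ∈ Finset.univ) => mode j
      linarith

lemma dn_pos {n : ℕ} (α : ℝ) {u : EV n → ℝ} (hu : Continuous u)
    (hc : HasCompactSupport u) (hs : tsupport u ⊆ {(0 : EV n)}ᶜ) (hne : ∃ x, u x ≠ 0) :
    0 < ∫ x, ‖x‖ ^ α * (u x) ^ 2 := by
  obtain ⟨x, hx⟩ := hne
  have hcc : Continuous fun x => ‖x‖ ^ α * (u x) ^ 2 := by
    simp only [sq, ← mul_assoc]
    exact (wcont hu hs α).mul hu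
  have hx0 : x ≠ 0 := fun h => hs (subset_tsupport u hx) h
  refine hcc.integral_pos_of_hasCompactSupport_nonneg_nonzero ?_ ?_ (x := x) ?_
  · have h2 : HasCompactSupport (fun x => (u x) ^ 2) := by
      simp only [sq]; exact hc.mul_left
    exact h2.mul_left
  · intro y
    exact mul_nonneg (Real.rpow_nonneg (norm_nonneg _) _) (sq_nonneg _)
  · have : 0 < ‖x‖ ^ α := Real.rpow_pos_of_pos (norm_pos_iff.2 hx0) _
    positivity

lemma lower {n : ℕ} (hn : 2 ≤ n) (α : ℝ) {u : EV n → ℝ} (hu : DirichletAdm {(0 : EV n)}ᶜ u)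
    (h0 : ∀ r : ℝ, 0 < r → (∫ σ, u (r • σ) ∂(sphMeasure n)) = 0) (hne : ∃ x, u x ≠ 0)
    {M : ℝ} (hM0 : 0 ≤ M) (hM : ∀ k : ℕ, 1 ≤ k → M ≤ (gam n α + lamk n k) ^ 2) :
    M ≤ (∫ x, ‖x‖ ^ α * (lap u x) ^ 2) / (∫ x, ‖x‖ ^ (α - 4) * (u x) ^ 2) := by
  obtain ⟨hu, hc, hs⟩ := hu
  have hpos := dn_pos (α - 4) hu.continuous hc hs hne
  rw [le_div_iff₀ hpos]
  have hls : tsupport (lap u) ⊆ tsupport u := lap_tsupport u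
  have hlc : HasCompactSupport (lap u) := hc.of_isClosed_subset (isClosed_tsupport _) hls
  rw [polar_w hn hu.continuous hc hs, polar_w hn (lap_continuous hu) hlc (hls.trans hs)]
  obtain ⟨S, hS⟩ := supp_log hc hs
  have e1 : ∀ s, Real.exp ((α + n) * s) * ∫ σ, (lap u (Real.exp s • σ)) ^ 2 ∂(sphMeasure n)
      = Real.exp ((α + n - 4) * s) *
      ∫ σ, (Real.exp (2 * s) * lap u (Real.exp s • σ)) ^ 2 ∂(sphMeasure n) := by
    intro s
    simp only [mul_pow, integral_const_mul]
    rw [← mul_assoc, ← Real.exp_nat_mul, ← Real.exp_add]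
    congr 2
    push_cast; ring
  have e2 : α - 4 + (n : ℝ) = α + n - 4 := by ring
  simp only [e1, e2]
  set C := (M * (∫ σ, (1:ℝ) ∂(sphMeasure n)) * ∫ s in Icc (-S) S, Real.exp ((α + n - 4) * s))
  have key : ∀ ε : ℝ, 0 < ε → _ := fun ε hε => lower_eps hn α hu hc hs h0 hM0 hM hS hε
  set A := M * (∫ s, Real.exp ((α + n - 4) * s) * ∫ σ, (u (Real.exp s • σ)) ^ 2 ∂(sphMeasure n))
  set B := (∫ s, Real.exp ((α + n - 4) * s) *
      ∫ σ, (Real.exp (2 * s) * lap u (Real.exp s • σ)) ^ 2 ∂(sphMeasure n))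
  have lim : Tendsto (fun ε : ℝ => B + ε ^ 2 * C) (nhdsWithin 0 (Ioi 0)) (nhds B) := by
    have : Continuous (fun ε : ℝ => B + ε ^ 2 * C) := by fun_prop
    have := this.tendsto 0
    simp at this
    exact this.mono_left nhdsWithin_le_nhds
  refine ge_of_tendsto lim ?_
  filter_upwards [self_mem_nhdsWithin] with ε hε using key ε hε

lemma Lop_rot {n : ℕ} (i j : Fin n) {h : EV n → ℝ} (hh : ContDiff ℝ 1 h) (x : EV n) :
    HasDerivAt (fun t => h (rotL i j t x)) (Lop (Jm i j) h x) 0 := by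
  have h1 : HasDerivAt (fun t => rotL i j t x) (Jm i j (rotL i j 0 x)) 0 := by
    simp only [rotL_apply, map_add, map_smul, Jm_cube]
    have a := (Real.hasDerivAt_cos 0).const_sub 1 |>.smul_const (Jm i j (Jm i j x))
    have b := (Real.hasDerivAt_sin 0).smul_const (Jm i j x)
    refine HasDerivAt.congr_deriv ((a.const_add x).add b) ?_
    module
  have := ((hh.differentiable (by norm_num)) (rotL i j 0 x)).hasFDerivAt.comp_hasDerivAt 0 h1
  have e : rotL i j 0 x = x := by simp [rotL_apply]
  rw [e] at this
  exact this

lemma Lop_sphere {n : ℕ} (i j : Fin n) {v w : EV n → ℝ} (hv : ContDiff ℝ 1 v)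
    (hw : ContDiff ℝ 1 w) {r : ℝ} (h : ∀ x, ‖x‖ = r → v x = w x) :
    ∀ x, ‖x‖ = r → Lop (Jm i j) v x = Lop (Jm i j) w x := by
  intro x hx
  have a := Lop_rot i j hv x
  have b := Lop_rot i j hw x
  have e : (fun t => v (rotL i j t x)) = fun t => w (rotL i j t x) := by
    ext t
    exact h _ (by rw [(rotL i j t).norm_map, hx])
  rw [e] at a
  exact a.unique b

lemma Aop_sphere {n : ℕ} {v w : EV n → ℝ} (hv : ContDiff ℝ 2 v)
    (hw : ContDiff ℝ 2 w) {r : ℝ} (h : ∀ x, ‖x‖ = r → v x = w x) :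
    ∀ x, ‖x‖ = r → Aop v x = Aop w x := by
  intro x hx
  rw [Aop_eq hv, Aop_eq hw]
  congr 1
  refine Finset.sum_congr rfl fun i _ => Finset.sum_congr rfl fun j _ => ?_
  exact Lop_sphere i j (Lop_contDiff _ hv) (Lop_contDiff _ hw)
    (Lop_sphere i j (hv.of_le (by norm_num)) (hw.of_le (by norm_num)) h) x hx

/-! harmonic polynomial -/

def zc {n : ℕ} (i j : Fin n) : EV n →L[ℝ] ℂ :=
  (EuclideanSpace.proj i : EV n →L[ℝ] ℝ).smulRight (1 : ℂ)
    + (EuclideanSpace.proj j : EV n →L[ℝ] ℝ).smulRight Complex.I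

def Hk {n : ℕ} (i j : Fin n) (c : ℂ) (k : ℕ) (x : EV n) : ℝ := (c * zc i j x ^ k).re

lemma Hk_contDiff {n : ℕ} (i j : Fin n) (c : ℂ) (k : ℕ) : ContDiff ℝ 2 (Hk i j c k) := by
  unfold Hk
  exact Complex.reCLM.contDiff.comp (contDiff_const.mul ((zc i j).contDiff.pow k))

lemma Hk_deriv {n : ℕ} (i j : Fin n) (c : ℂ) (k : ℕ) (v x : EV n) :
    fderiv ℝ (Hk i j c k) x v = Hk i j (c * k * zc i j v) (k - 1) x := by
  have h1 : HasFDerivAt (fun x => c * zc i j x ^ k) _ x := ((zc i j).hasFDerivAt.pow k).const_mul c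
  have h2 := (Complex.reCLM.hasFDerivAt.comp x h1).fderiv
  change fderiv ℝ (Complex.reCLM ∘ fun x => c * zc i j x ^ k) x v = _
  rw [h2]
  simp only [Hk, ContinuousLinearMap.comp_apply, Complex.reCLM_apply]
  congr 1
  simp
  ring

lemma Hk_lap {n : ℕ} {i j : Fin n} (hij : i ≠ j) (c : ℂ) (k : ℕ) (x : EV n) :
    lap (Hk i j c k) x = 0 := by
  rw [lap_eq' (Hk_contDiff i j c k)]
  simp only [Hk_deriv]
  have e : ∀ a : Fin n, Hk i j (c * k * zc i j (eb a) * ((k - 1 : ℕ) : ℂ) * zc i j (eb a)) (k - 1 - 1) x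
      = (c * k * ((k - 1 : ℕ) : ℂ) * zc i j x ^ (k - 1 - 1) * (zc i j (eb a)) ^ 2).re := by
    intro a
    unfold Hk
    congr 1
    ring
  refine (Finset.sum_congr rfl fun a _ => e a).trans ?_
  rw [← Complex.re_sum, ← Finset.mul_sum]
  have : ∑ a : Fin n, (zc i j (eb a)) ^ 2 = 0 := by
    have h : ∀ a : Fin n, (zc i j (eb a)) ^ 2 = (if a = i then 1 else 0) - (if a = j then 1 else 0) := by
      intro a
      by_cases h1 : a = i
      · subst h1
        simp [zc, eb_apply, hij, hij.symm]
      · by_cases h2 : a = j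
        · subst h2
          simp [zc, eb_apply, hij, h1]
        · simp [zc, eb_apply, h1, h2, Ne.symm h1, Ne.symm h2]
    simp only [h, Finset.sum_sub_distrib]
    simp
  rw [this]; simp

lemma Hk_homog {n : ℕ} (i j : Fin n) (c : ℂ) (k : ℕ) (r : ℝ) (x : EV n) :
    Hk i j c k (r • x) = r ^ k * Hk i j c k x := by
  unfold Hk
  rw [map_smul, Complex.real_smul, mul_pow, ← Complex.ofReal_pow, mul_left_comm, Complex.re_ofReal_mul]

lemma Hk_Aop {n : ℕ} {i j : Fin n} (hij : i ≠ j) (c : ℂ) (k : ℕ) (x : EV n) :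
    Aop (Hk i j c k) x = - lamk n k * Hk i j c k x := by
  rw [homog_Aop (Hk_contDiff i j c k) k (fun s x => by rw [Hk_homog, Real.exp_nat_mul]),
    Hk_lap hij, lamk]
  ring

lemma exists_H {n : ℕ} (hn : 2 ≤ n) {k : ℕ} (hk : 1 ≤ k) : ∃ H : EV n → ℝ, ContDiff ℝ 2 H ∧
    (∀ (r : ℝ) x, H (r • x) = r ^ k * H x) ∧ (∀ x, Aop H x = - lamk n k * H x) ∧
    (∫ σ, H σ ∂(sphMeasure n) = 0) ∧ (∃ σ, ‖σ‖ = 1 ∧ H σ ≠ 0) ∧ 0 < ∫ σ, (H σ) ^ 2 ∂(sphMeasure n) := by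
  let i : Fin n := ⟨0, by omega⟩
  let j : Fin n := ⟨1, by omega⟩
  have hij : i ≠ j := by simp [i, j]
  have hc := (Hk_contDiff i j 1 k)
  have hA := Hk_Aop hij 1 k
  have h1 : ‖(eb i : EV n)‖ = 1 := by simp [eb]
  have hz : zc i j (eb i) = 1 := by
    simp [zc, eb_apply, hij.symm]
  have h2 : Hk i j 1 k (eb i) = 1 := by simp [Hk, hz]
  refine ⟨Hk i j 1 k, hc, Hk_homog i j 1 k, hA, ?_, ⟨eb i, h1, by rw [h2]; norm_num⟩, ?_⟩
  · have h3 := Aop_selfadj hc (contDiff_const (c := (1 : ℝ)))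
    have h4 : ∀ x : EV n, Aop (fun _ : EV n => (1 : ℝ)) x = 0 := by
      intro x
      rw [Aop_eq contDiff_const]
      have : ∀ J : EV n →L[ℝ] EV n, Lop J (fun _ => (1 : ℝ)) = fun _ => 0 := by
        intro J; ext y; simp [Lop]
      simp only [this]
      simp [Lop]
    simp only [hA, h4, mul_zero, mul_one, integral_zero, integral_const_mul] at h3
    have h5 : 0 < lamk n k := by
      unfold lamk
      have : (2 : ℝ) ≤ n := by exact_mod_cast hn
      have : (1 : ℝ) ≤ k := by exact_mod_cast hk
      nlinarith
    rcases mul_eq_zero.1 h3 with h | h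
    · linarith
    · exact h
  · refine lt_of_le_of_ne (integral_nonneg fun σ => sq_nonneg _) fun h => ?_
    have := sph_zero hc.continuous h.symm _ h1
    rw [h2] at this
    norm_num at this

lemma test_adm {n : ℕ} {H : EV n → ℝ} (hH : ContDiff ℝ 2 H) (hH0 : H 0 = 0) {ψ : ℝ → ℝ}
    (hψ : ContDiff ℝ 2 ψ) (hc : HasCompactSupport ψ) :
    DirichletAdm {(0 : EV n)}ᶜ (fun x => ψ (Real.log ‖x‖) * H x) := by
  have hb : ∃ S, ∀ s ∈ tsupport ψ, ‖s‖ ≤ S :=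
    (show IsCompact (tsupport ψ) from hc).exists_bound_of_continuousOn continuousOn_id
  obtain ⟨S, hS⟩ := hb
  set K : Set (EV n) := closedBall 0 (Real.exp S) ∩ {x | Real.exp (-S) ≤ ‖x‖} with hK
  have hKc : IsCompact K :=
    (isCompact_closedBall _ _).inter_right (isClosed_le continuous_const continuous_norm)
  have hsub : ∀ x, x ∉ K → ψ (Real.log ‖x‖) * H x = 0 := by
    intro x hx
    by_contra h
    apply hx
    have h1 : ψ (Real.log ‖x‖) ≠ 0 := left_ne_zero_of_mul h
    have h2 : x ≠ 0 := fun h0 => right_ne_zero_of_mul h (by rw [h0, hH0])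
    have h3 := abs_le.1 (hS _ (subset_tsupport ψ h1))
    have hp : 0 < ‖x‖ := norm_pos_iff.2 h2
    refine ⟨?_, ?_⟩
    · rw [mem_closedBall_zero_iff]
      exact (Real.log_le_iff_le_exp hp).1 h3.2
    · exact (Real.le_log_iff_exp_le hp).1 h3.1
  have h0K : (0 : EV n) ∉ K := by
    rintro ⟨_, h⟩
    simp only [mem_setOf_eq, norm_zero] at h
    exact absurd h (not_le.2 (Real.exp_pos _))
  refine ⟨?_, HasCompactSupport.intro hKc hsub, ?_⟩
  · rw [contDiff_iff_contDiffAt]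
    intro x
    by_cases hx : x = 0
    · have : (fun x => ψ (Real.log ‖x‖) * H x) =ᶠ[nhds x] fun _ => 0 := by
        have : Kᶜ ∈ nhds x := hKc.isClosed.isOpen_compl.mem_nhds (by rw [hx]; exact h0K)
        filter_upwards [this] with y hy using hsub y hy
      exact contDiffAt_const.congr_of_eventuallyEq this
    · exact (hψ.contDiffAt.comp x ((contDiffAt_norm ℝ hx).log (by simpa using hx))).mul hH.contDiffAt
  · have : tsupport (fun x => ψ (Real.log ‖x‖) * H x) ⊆ K := by
      refine closure_minimal ?_ hKc.isClosed
      intro x hx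
      by_contra h
      exact hx (hsub x h)
    exact this.trans fun x hx h => h0K (by rw [← mem_singleton_iff.1 h]; exact hx)

lemma test_lap {n : ℕ} {H : EV n → ℝ} (hH : ContDiff ℝ 2 H) {k : ℕ}
    (hh : ∀ (r : ℝ) x, H (r • x) = r ^ k * H x) (hA : ∀ x, Aop H x = - lamk n k * H x) {ψ : ℝ → ℝ}
    (hu : ContDiff ℝ 2 (fun x : EV n => ψ (Real.log ‖x‖) * H x)) {φ φ1 φ2 : ℝ → ℝ}
    (hφ : ∀ s, φ s = ψ s * Real.exp (k * s))
    (d1 : ∀ s, HasDerivAt φ (φ1 s) s) (d2 : ∀ s, HasDerivAt φ1 (φ2 s) s) (s : ℝ) (σ : EV n)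
    (hσ : ‖σ‖ = 1) :
    ψ (Real.log ‖Real.exp s • σ‖) * H (Real.exp s • σ) = φ s * H σ ∧
    Real.exp (2 * s) * lap (fun x : EV n => ψ (Real.log ‖x‖) * H x) (Real.exp s • σ)
      = (φ2 s + ((n : ℝ) - 2) * φ1 s - lamk n k * φ s) * H σ := by
  set u := fun x : EV n => ψ (Real.log ‖x‖) * H x with hud
  have hnm : ∀ s, ‖Real.exp s • σ‖ = Real.exp s := fun s => by
    rw [norm_smul, hσ, mul_one, Real.norm_eq_abs, Real.abs_exp]
  have e0 : ∀ s, u (Real.exp s • σ) = φ s * H σ := by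
    intro s
    simp only [hud]
    rw [hnm, Real.log_exp, hh, hφ, Real.exp_nat_mul]; ring
  refine ⟨e0 s, ?_⟩
  have r1 : ∀ s, fderiv ℝ u (Real.exp s • σ) (Real.exp s • σ) = φ1 s * H σ := by
    intro s
    have a := ray1 hu σ s
    simp only [e0] at a
    exact a.unique ((d1 s).mul_const _)
  have r2 := ray2 hu σ s
  simp only [r1] at r2
  have r3 := r2.unique ((d2 s).mul_const _)
  have hcH : ContDiff ℝ 2 (fun x => ψ s * H x) := contDiff_const.mul hH
  have eA : Aop u (Real.exp s • σ) = - lamk n k * (φ s * H σ) := by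
    rw [Aop_sphere hu hcH (r := Real.exp s) (fun x hx => by simp only [hud]; rw [hx, Real.log_exp])
      _ (hnm s), Aop_cmul _ hH, hA, hh, hφ, Real.exp_nat_mul]
    ring
  have hnorm : ‖Real.exp s • σ‖ ^ 2 = Real.exp (2 * s) := by
    rw [hnm, ← Real.exp_nat_mul]
    norm_num
  unfold Aop at eA
  rw [hnorm, r1] at eA
  linear_combination eA + r3

lemma upper_eps {n : ℕ} (hn : 2 ≤ n) (α : ℝ) {k : ℕ} (hk : 1 ≤ k) : ∃ a b : ℝ, ∀ ε : ℝ, 0 < ε →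
    ∃ u : EV n → ℝ, DirichletAdm {(0 : EV n)}ᶜ u ∧
      (∀ r : ℝ, 0 < r → (∫ σ, u (r • σ) ∂(sphMeasure n)) = 0) ∧ (∃ x, u x ≠ 0) ∧
      (gam n α + lamk n k) ^ 2 + (ε ^ 4 * a + ε ^ 2 * b) =
        (∫ x, ‖x‖ ^ α * (lap u x) ^ 2) / (∫ x, ‖x‖ ^ (α - 4) * (u x) ^ 2) := by
  obtain ⟨H, hH, hh, hA, hmean, ⟨σ0, hσ0, hHσ0⟩, hh2⟩ := exists_H hn hk
  set h2 := ∫ σ, (H σ) ^ 2 ∂(sphMeasure n) with hh2d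
  have hH0 : H 0 = 0 := by
    have := hh 0 0
    rw [zero_smul, zero_pow (by omega), zero_mul] at this
    exact this
  let η : ContDiffBump (0 : ℝ) := default
  have hη : ContDiff ℝ 2 (η : ℝ → ℝ) := η.contDiff
  have hη1 : ContDiff ℝ 1 (deriv (η : ℝ → ℝ)) := by
    have : ContDiff ℝ (1 + 1) (η : ℝ → ℝ) := by simpa [one_add_one_eq_two] using hη
    exact (contDiff_succ_iff_deriv.1 this).2.2
  have hη2 : Continuous (deriv (deriv (η : ℝ → ℝ))) := hη1.continuous_deriv le_rfl
  have hηc : HasCompactSupport (η : ℝ → ℝ) := η.hasCompactSupport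
  have dη : ∀ s, HasDerivAt (η : ℝ → ℝ) (deriv η s) s := fun s =>
    (hη.differentiable (by norm_num) s).hasDerivAt
  have dη1 : ∀ s, HasDerivAt (deriv (η : ℝ → ℝ)) (deriv (deriv η) s) s := fun s =>
    (hη1.differentiable (by norm_num) s).hasDerivAt
  have hη0 : (η : ℝ → ℝ) 0 ≠ 0 := by
    rw [η.one_of_mem_closedBall (by simp [η.rIn_pos.le])]; norm_num
  set I0 := ∫ s, (η s) ^ 2 with hI0
  set I1 := ∫ s, (deriv (η : ℝ → ℝ) s) ^ 2 with hI1
  set I2 := ∫ s, (deriv (deriv (η : ℝ → ℝ)) s) ^ 2 with hI2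
  have hI0p : 0 < I0 := by
    refine (hη.continuous.pow 2).integral_pos_of_hasCompactSupport_nonneg_nonzero ?_ ?_ (x := 0) ?_
    · simp only [sq]; exact hηc.mul_left
    · intro s; exact sq_nonneg _
    · exact pow_ne_zero 2 hη0
  set b := 2 - α with hb
  set g := gam n α + lamk n k with hg
  set κ : ℝ := (α + n - 4) / 2 with hκ
  refine ⟨I2 / I0, (b ^ 2 + 2 * g) * (I1 / I0), fun ε hε => ?_⟩
  -- one dimensional profile
  set w : ℝ → ℝ := fun s => η (ε * s) with hw
  set w1 : ℝ → ℝ := fun s => ε * deriv (η : ℝ → ℝ) (ε * s) with hw1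
  set w2 : ℝ → ℝ := fun s => ε * (ε * deriv (deriv (η : ℝ → ℝ)) (ε * s)) with hw2
  have hlin : ∀ s, HasDerivAt (fun s => ε * s) ε s := fun s => by
    simpa using (hasDerivAt_id s).const_mul ε
  have dw : ∀ s, HasDerivAt w (w1 s) s := fun s =>
    ((dη (ε * s)).comp s (hlin s)).congr_deriv (by simp only [hw1]; ring)
  have dw1 : ∀ s, HasDerivAt w1 (w2 s) s := fun s =>
    (((dη1 (ε * s)).comp s (hlin s)).const_mul ε).congr_deriv (by simp only [hw2]; ring)
  have hw2c : Continuous w2 := by simp only [hw2]; fun_prop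
  have hwc : HasCompactSupport w :=
    hηc.comp_homeomorph (Homeomorph.mulLeft₀ ε hε.ne')
  have key := oneD dw dw1 hw2c hwc b g
  have J0 : ∫ s, (w s) ^ 2 = ε⁻¹ * I0 := by
    have := Measure.integral_comp_mul_left (fun s => (η s) ^ 2) ε
    simpa [abs_of_pos hε] using this
  have J1 : ∫ s, (w1 s) ^ 2 = ε * I1 := by
    have := Measure.integral_comp_mul_left (fun s => (deriv (η : ℝ → ℝ) s) ^ 2) ε
    simp only [hw1, mul_pow, integral_const_mul]
    rw [this, abs_of_pos (inv_pos.2 hε), smul_eq_mul, ← hI1]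
    field_simp
  have J2 : ∫ s, (w2 s) ^ 2 = ε ^ 3 * I2 := by
    have := Measure.integral_comp_mul_left (fun s => (deriv (deriv (η : ℝ → ℝ)) s) ^ 2) ε
    simp only [hw2, mul_pow, integral_const_mul]
    rw [this, abs_of_pos (inv_pos.2 hε), smul_eq_mul, ← hI2]
    field_simp
  rw [J0, J1, J2] at key
  -- radial profile
  set E : ℝ → ℝ := fun s => Real.exp (- κ * s) with hE
  have hEd : ∀ s, HasDerivAt E (- κ * E s) s := by
    intro s
    have := ((hasDerivAt_id s).const_mul (-κ)).exp
    refine this.congr_deriv ?_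
    simp [hE]; ring
  set φ : ℝ → ℝ := fun s => E s * w s with hφ
  set φ1 : ℝ → ℝ := fun s => E s * (w1 s - κ * w s) with hφ1
  set φ2 : ℝ → ℝ := fun s => E s * (w2 s - 2 * κ * w1 s + κ ^ 2 * w s) with hφ2
  have d1 : ∀ s, HasDerivAt φ (φ1 s) s := fun s =>
    ((hEd s).mul (dw s)).congr_deriv (by simp only [hφ1]; ring)
  have d2 : ∀ s, HasDerivAt φ1 (φ2 s) s := fun s =>
    ((hEd s).mul ((dw1 s).sub ((dw s).const_mul κ))).congr_deriv (by simp [hφ2]; ring)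
  set ψ : ℝ → ℝ := fun s => Real.exp (- (κ + k) * s) * η (ε * s) with hψ
  have hψs : ContDiff ℝ 2 ψ := by
    have h1 : ContDiff ℝ 2 (fun s : ℝ => Real.exp (- (κ + k) * s)) := by fun_prop
    have h2 : ContDiff ℝ 2 (fun s : ℝ => η (ε * s)) := hη.comp (by fun_prop)
    exact h1.mul h2
  have hψc : HasCompactSupport ψ := hwc.mul_left
  have hφψ : ∀ s, φ s = ψ s * Real.exp (k * s) := by
    intro s
    simp only [hφ, hψ, hE, hw]
    rw [mul_right_comm, ← Real.exp_add]
    ring_nf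
  have hadm := test_adm hH hH0 hψs hψc
  have hlap := test_lap hH hh hA hadm.1 hφψ d1 d2
  set u := fun x : EV n => ψ (Real.log ‖x‖) * H x with hu
  have hsc : ∀ s σ, ‖σ‖ = 1 → u (Real.exp s • σ) = φ s * H σ := fun s σ hσ => (hlap s σ hσ).1
  have hlp : ∀ s σ, ‖σ‖ = 1 → Real.exp (2 * s) * lap u (Real.exp s • σ)
      = (φ2 s + ((n : ℝ) - 2) * φ1 s - lamk n k * φ s) * H σ := fun s σ hσ => (hlap s σ hσ).2
  clear_value u
  refine ⟨u, hadm, ?_, ?_, ?_⟩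
  · intro r hr
    rw [← Real.exp_log hr, sph_congr (fun σ hσ => hsc (Real.log r) σ hσ), integral_const_mul, hmean,
      mul_zero]
  · refine ⟨Real.exp 0 • σ0, ?_⟩
    rw [hsc 0 _ hσ0]
    refine mul_ne_zero ?_ hHσ0
    simp [hφ, hE, hw, hη0]
  · obtain ⟨hus, hcs, hss⟩ := hadm
    have hls : tsupport (lap u) ⊆ tsupport u := lap_tsupport u
    have hlc : HasCompactSupport (lap u) := hcs.of_isClosed_subset (isClosed_tsupport _) hls
    rw [polar_w hn hus.continuous hcs hss, polar_w hn (lap_continuous hus) hlc (hls.trans hss)]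
    have hsq : ∀ s, Real.exp ((α + n - 4) * s) * (E s) ^ 2 = 1 := by
      intro s
      simp only [hE]
      rw [← Real.exp_nat_mul, ← Real.exp_add, ← Real.exp_zero]
      congr 1
      rw [hκ]; push_cast; ring
    have e1 : ∀ s, Real.exp ((α + n) * s) * ∫ σ, (lap u (Real.exp s • σ)) ^ 2 ∂(sphMeasure n)
        = h2 * (w2 s + b * w1 s - g * w s) ^ 2 := by
      intro s
      have : Real.exp ((α + n) * s) = Real.exp ((α + n - 4) * s) * Real.exp (2 * s) ^ 2 := by
        rw [← Real.exp_nat_mul, ← Real.exp_add]; congr 1; push_cast; ring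
      rw [this, mul_assoc, ← integral_const_mul]
      simp only [← mul_pow]
      rw [sph_congr (fun σ hσ => by rw [hlp s σ hσ])]
      simp only [mul_pow, integral_const_mul]
      have hs1 := hsq s
      simp only [hφ, hφ1, hφ2]
      have e : (E s * (w2 s - 2 * κ * w1 s + κ ^ 2 * w s) + ((n : ℝ) - 2) * (E s * (w1 s - κ * w s))
          - lamk n k * (E s * w s)) = E s * (w2 s + b * w1 s - g * w s) := by
        rw [hκ, hb, hg, gam]; ring
      rw [e, mul_pow]
      linear_combination (h2 * (w2 s + b * w1 s - g * w s) ^ 2) * hs1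
    have e2 : ∀ s, Real.exp ((α - 4 + n) * s) * ∫ σ, (u (Real.exp s • σ)) ^ 2 ∂(sphMeasure n)
        = h2 * (w s) ^ 2 := by
      intro s
      have : (α - 4 + n) * s = (α + n - 4) * s := by ring
      rw [this, sph_congr (fun σ hσ => by rw [hsc s σ hσ])]
      simp only [mul_pow, integral_const_mul, hφ]
      have hs1 := hsq s
      linear_combination (h2 * (w s) ^ 2) * hs1
    simp only [e1, e2, integral_const_mul]
    rw [key, J0]
    field_simp
    ring

lemma exists_min_k (n : ℕ) (hn : 2 ≤ n) (γ : ℝ) : ∃ k0 : ℕ, 1 ≤ k0 ∧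
    ∀ k : ℕ, 1 ≤ k → (γ + lamk n k0) ^ 2 ≤ (γ + lamk n k) ^ 2 := by
  have h2 : (2 : ℝ) ≤ n := by exact_mod_cast hn
  have ht : Tendsto (fun k : ℕ => (γ + lamk n (k + 1)) ^ 2) atTop atTop := by
    have h1 : Tendsto (fun k : ℕ => γ + lamk n (k + 1)) atTop atTop := by
      refine tendsto_atTop_add_const_left _ _ ?_
      refine tendsto_atTop_mono (f := fun k : ℕ => (k : ℝ)) (fun k => ?_) tendsto_natCast_atTop_atTop
      unfold lamk
      have : (0 : ℝ) ≤ k := Nat.cast_nonneg k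
      push_cast
      nlinarith
    exact (tendsto_pow_atTop (by norm_num)).comp h1
  rw [← Nat.cofinite_eq_atTop] at ht
  obtain ⟨k0, hk0⟩ := ht.exists_forall_le
  refine ⟨k0 + 1, by omega, fun k hk => ?_⟩
  have := hk0 (k - 1)
  rwa [Nat.sub_add_cancel hk] at this

/-- the Rellich quotient restricted to functions with zero mean
on every sphere centered at the origin has infimum
`min_{k ≥ 1} |γ_{n,α} + k(n-2+k)|²`. -/
theorem rellich_nonradial {n : ℕ} (hn : 2 ≤ n) (α : ℝ) :
    IsLeast
      {v : ℝ | ∃ k : ℕ, 1 ≤ k ∧ v = (gam n α + (k : ℝ) * ((n : ℝ) - 2 + (k : ℝ))) ^ 2}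
      (sInf {q : ℝ | ∃ u : EuclideanSpace ℝ (Fin n) → ℝ,
        DirichletAdm {(0 : EuclideanSpace ℝ (Fin n))}ᶜ u ∧
        (∀ r : ℝ, 0 < r → (∫ σ, u (r • σ) ∂(sphMeasure n)) = 0) ∧ (∃ x, u x ≠ 0) ∧
        q = (∫ x, ‖x‖ ^ α * (lap u x) ^ 2) / (∫ x, ‖x‖ ^ (α - 4) * (u x) ^ 2)}) := by
  obtain ⟨k0, hk0, hmin⟩ := exists_min_k n hn (gam n α)
  set T := {q : ℝ | ∃ u : EuclideanSpace ℝ (Fin n) → ℝ,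
        DirichletAdm {(0 : EuclideanSpace ℝ (Fin n))}ᶜ u ∧
        (∀ r : ℝ, 0 < r → (∫ σ, u (r • σ) ∂(sphMeasure n)) = 0) ∧ (∃ x, u x ≠ 0) ∧
        q = (∫ x, ‖x‖ ^ α * (lap u x) ^ 2) / (∫ x, ‖x‖ ^ (α - 4) * (u x) ^ 2)} with hT
  have hlow : ∀ q ∈ T, (gam n α + lamk n k0) ^ 2 ≤ q := by
    rintro q ⟨u, hu, h0, hne, rfl⟩
    exact lower hn α hu h0 hne (sq_nonneg _) hmin
  have hbdd : BddBelow T := ⟨_, hlow⟩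
  obtain ⟨a, b, hab⟩ := upper_eps hn α hk0
  have hmem : ∀ ε : ℝ, 0 < ε → (gam n α + lamk n k0) ^ 2 + (ε ^ 4 * a + ε ^ 2 * b) ∈ T := by
    intro ε hε
    obtain ⟨u, h1, h2, h3, h4⟩ := hab ε hε
    exact ⟨u, h1, h2, h3, h4⟩
  have heq : sInf T = (gam n α + lamk n k0) ^ 2 := by
    refine le_antisymm ?_ (le_csInf ⟨_, hmem 1 one_pos⟩ hlow)
    have lim : Tendsto (fun ε : ℝ => (gam n α + lamk n k0) ^ 2 + (ε ^ 4 * a + ε ^ 2 * b))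
        (nhdsWithin 0 (Ioi 0)) (nhds ((gam n α + lamk n k0) ^ 2)) := by
      have hcont : Continuous
          (fun ε : ℝ => (gam n α + lamk n k0) ^ 2 + (ε ^ 4 * a + ε ^ 2 * b)) := by fun_prop
      have h0 := hcont.tendsto 0
      simp at h0
      exact h0.mono_left nhdsWithin_le_nhds
    refine ge_of_tendsto lim ?_
    filter_upwards [self_mem_nhdsWithin] with ε hε using csInf_le hbdd (hmem ε hε)
  rw [heq]
  refine ⟨⟨k0, hk0, rfl⟩, ?_⟩
  rintro v ⟨k, hk, rfl⟩
  exact hmin k hk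

end
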